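/- arXiv:2312.11702 — 4 statements merged into one kernel-verified Lean document; each statement's English description precedes it below -/
import Mathlib

section
/- Let A ∈ Mat_{m×n}(ℚ_p), and let B be a d×ℓ submatrix of A (obtained by selecting d of the rows and ℓ of the columns). Then for every 1 ≤ k ≤ min(d,ℓ), the sums of the k smallest singular numbers satisfy Σ_{j=1}^k SN(B)_{min(d,ℓ)−j+1} ≥ Σ_{j=1}^k SN(A)_{min(m,n)−j+1}, with sums involving ∞ interpreted as ∞. -/
/-!
Statement 2: if `B` is a `d × ℓ` submatrix of `A ∈ Mat_{m×n}(ℚ_p)` (selecting `d` rows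
and `ℓ` columns), then for every `1 ≤ k ≤ min d ℓ`, the sum of the `k` smallest singular
numbers of `B` is at least the sum of the `k` smallest singular numbers of `A`.
-/

noncomputable section

/-- `p^a ∈ ℚ_p` for `a ∈ ℤ ∪ {∞}`, with the convention `p^∞ = 0`. -/
def qppow (p : ℕ) [Fact p.Prime] (a : WithTop ℤ) : ℚ_[p] :=
  if h : a = ⊤ then 0 else (p : ℚ_[p]) ^ (a.untop h)

/-- The rectangular `n × m` diagonal matrix whose `(i,i)` entry is `p^(f i)`. -/
def rectDiag (p : ℕ) [Fact p.Prime] (n m : ℕ) (f : ℕ → WithTop ℤ) :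
    Matrix (Fin n) (Fin m) ℚ_[p] :=
  Matrix.of fun i j => if (i : ℕ) = (j : ℕ) then qppow p (f (i : ℕ)) else 0

/-- `s` is the (weakly decreasing) tuple of singular numbers of the `n × m` matrix `A`
over `ℚ_p`. -/
def IsSN (p : ℕ) [Fact p.Prime] (n m : ℕ) (A : Matrix (Fin n) (Fin m) ℚ_[p])
    (s : Fin (min n m) → WithTop ℤ) : Prop :=
  Antitone s ∧ ∃ (U : (Matrix (Fin n) (Fin n) ℤ_[p])ˣ) (V : (Matrix (Fin m) (Fin m) ℤ_[p])ˣ),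
    A = (U.val.map (fun x : ℤ_[p] => (x : ℚ_[p]))) *
      rectDiag p n m (fun i => if h : i < min n m then s ⟨i, h⟩ else ⊤) *
      (V.val.map (fun x : ℤ_[p] => (x : ℚ_[p])))

open Finset in
/-- A monotone function on `ℕ` has its smallest sum over `k` distinct indices on `range k`. -/
lemma sum_range_le_sum_of_injective {M : Type*} [AddCommMonoid M] [PartialOrder M]
    [IsOrderedAddMonoid M] {g : ℕ → M} (hg : Monotone g) {k : ℕ} {r : Fin k → ℕ}
    (hr : Function.Injective r) : ∑ j ∈ range k, g j ≤ ∑ i, g (r i) := by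
  have hcard : (univ.image r).card = k := by simp [card_image_of_injective _ hr]
  have hle : ∀ i : ℕ, ∀ hi : i < k, i ≤ (univ.image r).orderEmbOfFin hcard ⟨i, hi⟩ := by
    intro i
    induction i with
    | zero => simp
    | succ i ih =>
      intro hi
      have hlt : (univ.image r).orderEmbOfFin hcard ⟨i, by omega⟩ <
          (univ.image r).orderEmbOfFin hcard ⟨i + 1, hi⟩ :=
        (OrderEmbedding.strictMono _) (by simp)
      have := ih (by omega)
      omega
  calc ∑ j ∈ range k, g j = ∑ i : Fin k, g i := (Fin.sum_univ_eq_sum_range g k).symm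
    _ ≤ ∑ i : Fin k, g ((univ.image r).orderEmbOfFin hcard i) :=
        sum_le_sum fun i _ => hg (hle i i.2)
    _ = ∑ x ∈ univ.image ((univ.image r).orderEmbOfFin hcard), g x :=
        (sum_image fun _ _ _ _ h => ((univ.image r).orderEmbOfFin hcard).injective h).symm
    _ = ∑ x ∈ univ.image r, g x := by rw [image_orderEmbOfFin_univ]
    _ = ∑ i, g (r i) := sum_image fun _ _ _ _ h => hr h

section

variable {p : ℕ} [Fact p.Prime]

@[simp]
lemma qppow_top : qppow p ⊤ = 0 := by simp [qppow]

@[simp]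
lemma qppow_coe (a : ℤ) : qppow p (a : WithTop ℤ) = (p : ℚ_[p]) ^ a := by simp [qppow]

lemma qppow_add (a b : WithTop ℤ) : qppow p (a + b) = qppow p a * qppow p b := by
  have hp : (p : ℚ_[p]) ≠ 0 := by exact_mod_cast (Fact.out : p.Prime).ne_zero
  cases a using WithTop.recTopCoe with
  | top => simp
  | coe a =>
    cases b using WithTop.recTopCoe with
    | top => simp
    | coe b => rw [← WithTop.coe_add, qppow_coe, qppow_coe, qppow_coe, zpow_add₀ hp]

lemma qppow_sum {ι : Type*} (s : Finset ι) (f : ι → WithTop ℤ) :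
    qppow p (∑ i ∈ s, f i) = ∏ i ∈ s, qppow p (f i) := by
  classical
  induction s using Finset.induction_on with
  | empty => rw [Finset.sum_empty, Finset.prod_empty, ← WithTop.coe_zero, qppow_coe, zpow_zero]
  | insert a s ha ih => rw [Finset.sum_insert ha, Finset.prod_insert ha, qppow_add, ih]

lemma norm_qppow_le_norm_qppow {a b : WithTop ℤ} : ‖qppow p a‖ ≤ ‖qppow p b‖ ↔ b ≤ a := by
  have hp : (1 : ℝ) < p := by exact_mod_cast (Fact.out : p.Prime).one_lt
  cases a using WithTop.recTopCoe with
  | top => simp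
  | coe a =>
    cases b using WithTop.recTopCoe with
    | top =>
      simpa using zpow_pos (zero_lt_one.trans hp) a
    | coe b =>
      rw [qppow_coe, qppow_coe, Padic.norm_p_zpow, Padic.norm_p_zpow,
        zpow_le_zpow_iff_right₀ hp, neg_le_neg_iff, WithTop.coe_le_coe]

/-- The minors of a diagonal matrix multiplied by integral matrices are bounded by those of the
diagonal matrix. -/
lemma norm_det_mul_diagonal_mul_le {k m : ℕ} (X : Matrix (Fin k) (Fin m) ℤ_[p])
    (Y : Matrix (Fin m) (Fin k) ℤ_[p]) (q : Fin m → ℚ_[p]) {C : ℝ} (hC : 0 ≤ C)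
    (h : ∀ r : Fin k → Fin m, Function.Injective r → ‖∏ i, q (r i)‖ ≤ C) :
    ‖(X.map PadicInt.Coe.ringHom * Matrix.diagonal q * Y.map PadicInt.Coe.ringHom).det‖ ≤ C := by
  have hexp : (X.map PadicInt.Coe.ringHom * Matrix.diagonal q * Y.map PadicInt.Coe.ringHom).det =
      ∑ r : Fin k → Fin m, PadicInt.Coe.ringHom ((∏ i, X i (r i)) * (Y.submatrix r id).det) *
        ∏ i, q (r i) := by
    have hrow : X.map PadicInt.Coe.ringHom * Matrix.diagonal q * Y.map PadicInt.Coe.ringHom =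
        fun i => ∑ r, (PadicInt.Coe.ringHom (X i r) * q r) • (Y.map PadicInt.Coe.ringHom) r := by
      ext i j
      rw [Matrix.mul_apply, Finset.sum_apply]
      simp [Matrix.mul_diagonal]
    rw [hrow]
    refine (Matrix.detRowAlternating.toMultilinearMap.map_sum
      fun i r => (PadicInt.Coe.ringHom (X i r) * q r) • (Y.map PadicInt.Coe.ringHom) r).trans ?_
    refine Finset.sum_congr rfl fun r _ => ?_
    rw [MultilinearMap.map_smul_univ, Finset.prod_mul_distrib, map_mul, map_prod, RingHom.map_det]
    change _ * (RingHom.mapMatrix PadicInt.Coe.ringHom (Y.submatrix r id)).det = _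
    ring
  rw [hexp]
  refine IsUltrametricDist.norm_sum_le_of_forall_le_of_nonneg hC fun r _ => ?_
  by_cases hr : Function.Injective r
  · rw [norm_mul]
    refine (mul_le_of_le_one_left (norm_nonneg _) ?_).trans (h r hr)
    exact PadicInt.norm_le_one _
  · obtain ⟨i, j, hij, hne⟩ := Function.not_injective_iff.mp hr
    rw [Matrix.det_zero_of_row_eq (M := Y.submatrix r id) hne (by ext; simp [hij])]
    simpa using hC

lemma rectDiag_eq_diagonal_mul (n m : ℕ) (f : ℕ → WithTop ℤ) :
    rectDiag p n m f = Matrix.diagonal (fun i : Fin n => qppow p (f i)) *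
      (Matrix.of fun (i : Fin n) (j : Fin m) =>
        if (i : ℕ) = j then (1 : ℤ_[p]) else 0).map PadicInt.Coe.ringHom := by
  ext i j
  rw [Matrix.diagonal_mul]
  by_cases h : (i : ℕ) = j <;> simp [rectDiag, h]

end

theorem statement2 (p : ℕ) [Fact p.Prime] (m n d ℓ : ℕ)
    (hdm : d ≤ m) (hln : ℓ ≤ n)
    (A : Matrix (Fin m) (Fin n) ℚ_[p])
    (ρ : Fin d → Fin m) (hρ : Function.Injective ρ)
    (σ : Fin ℓ → Fin n) (hσ : Function.Injective σ)
    (sa : Fin (min m n) → WithTop ℤ) (hsa : IsSN p m n A sa)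
    (sb : Fin (min d ℓ) → WithTop ℤ) (hsb : IsSN p d ℓ (A.submatrix ρ σ) sb)
    (k : ℕ) (hk1 : 1 ≤ k) (hk2 : k ≤ min d ℓ) :
    ∑ j ∈ Finset.range k, sa ⟨min m n - 1 - j, by omega⟩ ≤
      ∑ j ∈ Finset.range k, sb ⟨min d ℓ - 1 - j, by omega⟩ := by
  obtain ⟨hanti, U, V, hA⟩ := hsa
  obtain ⟨-, U', V', hB⟩ := hsb
  let ι := PadicInt.Coe.ringHom (p := p)
  let N := min m n
  let fa : ℕ → WithTop ℤ := fun i => if h : i < min m n then sa ⟨i, h⟩ else ⊤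
  let fb : ℕ → WithTop ℤ := fun i => if h : i < min d ℓ then sb ⟨i, h⟩ else ⊤
  let g : ℕ → WithTop ℤ := fun j => if j < N then fa (N - 1 - j) else ⊤
  let e : Fin k → Fin d := fun i => ⟨min d ℓ - 1 - i, by omega⟩
  let e' : Fin k → Fin ℓ := fun i => ⟨min d ℓ - 1 - i, by omega⟩
  let E : Matrix (Fin m) (Fin n) ℤ_[p] := Matrix.of fun i j => if (i : ℕ) = j then 1 else 0
  let q : Fin m → ℚ_[p] := fun i => qppow p (fa i)
  have hA' : A = U.val.map ι * (Matrix.diagonal q * E.map ι) * V.val.map ι := by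
    rw [← rectDiag_eq_diagonal_mul]
    exact hA
  have hB' : A.submatrix ρ σ = U'.val.map ι * rectDiag p d ℓ fb * V'.val.map ι := hB
  have hU : (U'⁻¹).val.map ι * U'.val.map ι = 1 := by
    rw [← Matrix.map_mul, Units.inv_mul, Matrix.map_one _ (map_zero _) (map_one _)]
  have hV : V'.val.map ι * (V'⁻¹).val.map ι = 1 := by
    rw [← Matrix.map_mul, Units.mul_inv, Matrix.map_one _ (map_zero _) (map_one _)]
  have hD : rectDiag p d ℓ fb = (U'⁻¹).val.map ι * A.submatrix ρ σ * (V'⁻¹).val.map ι := by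
    rw [hB', ← Matrix.mul_assoc, ← Matrix.mul_assoc, hU, Matrix.one_mul, Matrix.mul_assoc, hV,
      Matrix.mul_one]
  have hsub : (rectDiag p d ℓ fb).submatrix e e' =
      (((U'⁻¹).val * U.val.submatrix ρ id).submatrix e id).map ι * Matrix.diagonal q *
        ((E * V.val.submatrix id σ * (V'⁻¹).val).submatrix id e').map ι := by
    have hAs : A.submatrix ρ σ = (U.val.submatrix ρ id).map ι * Matrix.diagonal q *
        (E.map ι * (V.val.submatrix id σ).map ι) := by
      rw [hA', ← Matrix.mul_assoc, Matrix.mul_assoc _ (E.map ι)]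
      rfl
    have hassoc : rectDiag p d ℓ fb =
        ((U'⁻¹).val * U.val.submatrix ρ id).map ι * Matrix.diagonal q *
          (E * V.val.submatrix id σ * (V'⁻¹).val).map ι := by
      rw [hD, hAs, Matrix.map_mul, Matrix.map_mul, Matrix.map_mul]
      simp only [Matrix.mul_assoc]
    rw [hassoc]
    rfl
  have hdiag : (rectDiag p d ℓ fb).submatrix e e' =
      Matrix.diagonal fun i : Fin k => qppow p (fb (min d ℓ - 1 - i)) := by
    ext i j
    by_cases h : i = j
    · subst h
      simp [rectDiag, e, e']
    · have : min d ℓ - 1 - (i : ℕ) ≠ min d ℓ - 1 - j := by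
        have := Fin.val_ne_of_ne h
        omega
      simp [rectDiag, e, e', h, this]
  have hg : Monotone g := by
    intro i j hij
    by_cases hj : j < N
    · have hi : i < N := by omega
      have hi' : N - 1 - i < min m n := by omega
      have hj' : N - 1 - j < min m n := by omega
      simp only [g, fa, hi, hj, hi', hj', if_true, dif_pos]
      exact hanti (Fin.mk_le_mk.mpr (by omega))
    · simp [g, hj]
  have hmin : ∀ r : Fin k → Fin m, Function.Injective r →
      ∑ j ∈ Finset.range k, g j ≤ ∑ i, fa (r i) := by
    intro r hr
    have hinj : Function.Injective fun i => if (r i : ℕ) < N then N - 1 - r i else (r i : ℕ) := by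
      intro i j hij
      apply hr
      ext
      dsimp only at hij
      split_ifs at hij <;> omega
    refine (sum_range_le_sum_of_injective hg hinj).trans_eq (Finset.sum_congr rfl fun i _ => ?_)
    by_cases h : (r i : ℕ) < N
    · have h1 : N - 1 - r i < N := by omega
      have h2 : N - 1 - (N - 1 - r i) = r i := by omega
      simp only [g, h, h1, h2, if_true]
    · have h' : ¬ (r i : ℕ) < min m n := h
      simp only [g, fa, h, h', if_false, dif_neg, not_false_eq_true]
  have key := norm_det_mul_diagonal_mul_le
    (((U'⁻¹).val * U.val.submatrix ρ id).submatrix e id)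
    ((E * V.val.submatrix id σ * (V'⁻¹).val).submatrix id e') q
    (norm_nonneg (qppow p (∑ j ∈ Finset.range k, g j))) fun r hr => by
      rw [← qppow_sum, norm_qppow_le_norm_qppow]
      exact hmin r hr
  have hdet := congrArg Matrix.det (hsub.symm.trans hdiag)
  rw [hdet, Matrix.det_diagonal, ← qppow_sum, norm_qppow_le_norm_qppow,
    Fin.sum_univ_eq_sum_range (fun i => fb (min d ℓ - 1 - i))] at key
  refine le_of_eq_of_le ?_ (key.trans_eq ?_)
  · refine Finset.sum_congr rfl fun j hj => ?_
    have hj' := Finset.mem_range.mp hj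
    have h1 : j < N := by omega
    have h2 : N - 1 - j < min m n := by omega
    simp only [g, fa, h1, h2, if_true, dif_pos]
    rfl
  · refine Finset.sum_congr rfl fun j hj => ?_
    have h2 : min d ℓ - 1 - j < min d ℓ := by omega
    simp only [fb, h2, dif_pos]
end
end

section
/- Let A be a random matrix in Mat_N(ℤ_p) whose columns v_N, v_{N−1}, …, v_1 are sampled from right to left as follows: the conditional distribution of v_i given v_{i+1},…,v_N is the additive Haar probability measure on ℤ_p^N conditioned on the (positive-probability) event that v_i mod p does not lie in the 𝔽_p-linear span of v_{i+1} mod p, …, v_N mod p inside 𝔽_p^N (for i = N the span is taken to be the zero subspace). Then A is distributed according to the Haar probability measure on the compact group GL_N(ℤ_p). -/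
/-!
Statement 3 (Proposition `haar_sampling`): let `A` be a random matrix in `Mat_N(ℤ_p)`
whose columns are sampled from right to left, the conditional distribution of column `i`
given the later columns being the additive Haar measure on `ℤ_p^N` conditioned on the
event that the column mod `p` avoids the `𝔽_p`-span of the later columns mod `p`.  Then
`A` is Haar-distributed on `GL_N(ℤ_p)`: its law is a left-`GL_N(ℤ_p)`-invariant
probability measure concentrated on the invertible matrices.

The conditional-sampling hypothesis is encoded by: for each `i` and measurable sets `B`
(for column `i`) and `C` (for the tuple of columns `> i`),
`Pr(col_i ∈ B, cols_{>i} ∈ C) = ∫_C (Haar conditioned on the span event for w)(B) dLaw(cols_{>i})(w)`.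
-/

open MeasureTheory

noncomputable section

instance padicMS (p : ℕ) [Fact p.Prime] : MeasurableSpace ℤ_[p] := borel _

instance matrixMS (p N : ℕ) [Fact p.Prime] :
    MeasurableSpace (Matrix (Fin N) (Fin N) ℤ_[p]) :=
  inferInstanceAs (MeasurableSpace (Fin N → Fin N → ℤ_[p]))

/-- The tuple of columns of `A` with index `> i`. -/
def laterCols (p N : ℕ) [Fact p.Prime] (i : Fin N) (A : Matrix (Fin N) (Fin N) ℤ_[p]) :
    {j : Fin N // i < j} → Fin N → ℤ_[p] :=
  fun j k => A k j.val

/-- The set of vectors in `ℤ_p^N` whose reduction mod `p` avoids the `𝔽_p`-span of the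
reductions of the vectors `w j`. -/
def avoidSpan (p N : ℕ) [Fact p.Prime] {ι : Type} (w : ι → Fin N → ℤ_[p]) :
    Set (Fin N → ℤ_[p]) :=
  {x | (fun k => PadicInt.toZMod (x k)) ∉
    Submodule.span (ZMod p) (Set.range fun j : ι => fun k => PadicInt.toZMod (w j k))}

namespace HaarSampling

open ProbabilityTheory

open scoped Matrix

variable {p N : ℕ} [Fact p.Prime]

instance : BorelSpace ℤ_[p] := ⟨rfl⟩

/-- Entrywise reduction mod `p` of a vector. -/
def reduce (x : Fin N → ℤ_[p]) : Fin N → ZMod p := fun k => PadicInt.toZMod (x k)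

theorem reduce_mulVec (M : Matrix (Fin N) (Fin N) ℤ_[p]) (x : Fin N → ℤ_[p]) :
    reduce (M *ᵥ x) = M.map PadicInt.toZMod *ᵥ reduce x := by
  funext k
  exact RingHom.map_mulVec PadicInt.toZMod M x k

theorem mem_avoidSpan {ι : Type} {w : ι → Fin N → ℤ_[p]} {x : Fin N → ℤ_[p]} :
    x ∈ avoidSpan p N w ↔
      reduce x ∉ Submodule.span (ZMod p) (Set.range fun j => reduce (w j)) :=
  Iff.rfl

theorem mem_avoidSpan_of_mulVec_mem {ι : Type} (M : Matrix (Fin N) (Fin N) ℤ_[p])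
    {w : ι → Fin N → ℤ_[p]} {x : Fin N → ℤ_[p]}
    (h : M *ᵥ x ∈ avoidSpan p N fun j => M *ᵥ w j) : x ∈ avoidSpan p N w := by
  rw [mem_avoidSpan] at h ⊢
  contrapose! h
  have := Submodule.mem_map_of_mem (f := Matrix.mulVecLin (M.map PadicInt.toZMod)) h
  rw [Submodule.map_span, ← Set.range_comp] at this
  simpa [reduce_mulVec, Function.comp_def] using this

theorem mulVec_mem_avoidSpan_iff {ι : Type} (U : (Matrix (Fin N) (Fin N) ℤ_[p])ˣ)
    (w : ι → Fin N → ℤ_[p]) (x : Fin N → ℤ_[p]) :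
    (U.val *ᵥ x ∈ avoidSpan p N fun j => U.val *ᵥ w j) ↔ x ∈ avoidSpan p N w := by
  refine ⟨mem_avoidSpan_of_mulVec_mem _, fun h => ?_⟩
  refine mem_avoidSpan_of_mulVec_mem (U⁻¹).val ?_
  simpa [Matrix.mulVec_mulVec, ← Units.val_mul] using h

theorem measurable_mulVec (M : Matrix (Fin N) (Fin N) ℤ_[p]) :
    Measurable fun x : Fin N → ℤ_[p] => M *ᵥ x :=
  (Continuous.matrix_mulVec continuous_const continuous_id).measurable

/-- The action of an invertible matrix on `ℤ_p^N`. -/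
def mulVecEquiv (U : (Matrix (Fin N) (Fin N) ℤ_[p])ˣ) :
    (Fin N → ℤ_[p]) ≃ᵐ (Fin N → ℤ_[p]) where
  toFun x := U.val *ᵥ x
  invFun x := (U⁻¹).val *ᵥ x
  left_inv x := by simp [Matrix.mulVec_mulVec]
  right_inv x := by simp [Matrix.mulVec_mulVec]
  measurable_toFun := measurable_mulVec _
  measurable_invFun := measurable_mulVec _

theorem mulVecEquiv_apply (U : (Matrix (Fin N) (Fin N) ℤ_[p])ˣ) (x : Fin N → ℤ_[p]) :
    mulVecEquiv U x = U.val *ᵥ x := rfl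

/-- A translation-invariant probability measure on `ℤ_p^N` is `GL_N(ℤ_p)`-invariant. -/
theorem map_mulVecEquiv {ν : Measure (Fin N → ℤ_[p])} [IsProbabilityMeasure ν]
    (hν : ∀ c : Fin N → ℤ_[p], Measure.map (fun x => c + x) ν = ν)
    (U : (Matrix (Fin N) (Fin N) ℤ_[p])ˣ) : Measure.map (mulVecEquiv U) ν = ν := by
  have : ν.IsAddLeftInvariant := ⟨hν⟩
  have : (Measure.map (mulVecEquiv U) ν).IsAddLeftInvariant := by
    refine ⟨fun c => ?_⟩
    conv_rhs => rw [← hν ((mulVecEquiv U).symm c)]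
    rw [Measure.map_map (measurable_const_add c) (mulVecEquiv U).measurable,
      Measure.map_map (mulVecEquiv U).measurable (measurable_const_add _)]
    congr 1
    funext x
    simp only [Function.comp_apply]
    rw [mulVecEquiv_apply U (_ + x), Matrix.mulVec_add, ← mulVecEquiv_apply, ← mulVecEquiv_apply,
      MeasurableEquiv.apply_symm_apply]
  have : IsProbabilityMeasure (Measure.map (mulVecEquiv U) ν) :=
    Measure.isProbabilityMeasure_map (mulVecEquiv U).measurable.aemeasurable
  have h₁ : ν.IsAddHaarMeasure :=
    Measure.isAddHaarMeasure_of_isCompact_nonempty_interior ν Set.univ isCompact_univ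
      (by simp) (by simp) (by simp)
  have h₂ : (Measure.map (mulVecEquiv U) ν).IsAddHaarMeasure :=
    Measure.isAddHaarMeasure_of_isCompact_nonempty_interior _ Set.univ isCompact_univ
      (by simp) (by simp) (by simp)
  exact Measure.isAddHaarMeasure_eq_of_isProbabilityMeasure _ _

theorem cond_avoidSpan_mulVec {ν : Measure (Fin N → ℤ_[p])} [IsProbabilityMeasure ν]
    (hν : ∀ c : Fin N → ℤ_[p], Measure.map (fun x => c + x) ν = ν)
    (U : (Matrix (Fin N) (Fin N) ℤ_[p])ˣ) {ι : Type} (w : ι → Fin N → ℤ_[p])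
    {B : Set (Fin N → ℤ_[p])} (hB : MeasurableSet B) :
    cond ν (avoidSpan p N fun j => U.val *ᵥ w j) B =
      cond ν (avoidSpan p N w) (mulVecEquiv U ⁻¹' B) := by
  have hpre (s : Set (Fin N → ℤ_[p])) : ν (mulVecEquiv U ⁻¹' s) = ν s := by
    rw [← (mulVecEquiv U).map_apply, map_mulVecEquiv hν]
  have havoid : mulVecEquiv U ⁻¹' (avoidSpan p N fun j => U.val *ᵥ w j) = avoidSpan p N w :=
    Set.ext (mulVec_mem_avoidSpan_iff U w)
  rw [cond_apply' hB, cond_apply' ((mulVecEquiv U).measurable hB), ← havoid,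
    ← Set.preimage_inter, hpre, hpre]

/-- The law `μ` of a random matrix is that of a matrix whose columns are sampled from right to
left, each from `ν` conditioned on avoiding the span mod `p` of the later columns. -/
def IsSampledFrom (ν : Measure (Fin N → ℤ_[p]))
    (μ : Measure (Matrix (Fin N) (Fin N) ℤ_[p])) : Prop :=
  ∀ i : Fin N, ∀ B : Set (Fin N → ℤ_[p]), MeasurableSet B →
    ∀ C : Set ({j : Fin N // i < j} → Fin N → ℤ_[p]), MeasurableSet C →
    μ {A | (fun k => A k i) ∈ B ∧ laterCols p N i A ∈ C} =
      ∫⁻ w in C, cond ν (avoidSpan p N w) B ∂(Measure.map (laterCols p N i) μ)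

theorem measurable_entry (i j : Fin N) :
    Measurable fun A : Matrix (Fin N) (Fin N) ℤ_[p] => A i j :=
  (measurable_pi_apply (X := fun _ => ℤ_[p]) j).comp
    (measurable_pi_apply (X := fun _ => Fin N → ℤ_[p]) i)

theorem measurable_of_entries {α : Type*} [MeasurableSpace α]
    {f : α → Matrix (Fin N) (Fin N) ℤ_[p]} (h : ∀ i j, Measurable fun a => f a i j) :
    Measurable f :=
  measurable_pi_lambda (X := fun _ => Fin N → ℤ_[p]) f
    fun i => measurable_pi_lambda _ fun j => h i j

theorem measurable_col (i : Fin N) :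
    Measurable fun (A : Matrix (Fin N) (Fin N) ℤ_[p]) k => A k i :=
  measurable_pi_lambda _ fun k => measurable_entry k i

theorem measurable_laterCols (i : Fin N) : Measurable (laterCols p N i) :=
  measurable_pi_lambda _ fun j => measurable_col j.val

theorem measurable_mul_left (M : Matrix (Fin N) (Fin N) ℤ_[p]) :
    Measurable fun A => M * A :=
  measurable_of_entries fun i j =>
    (measurable_pi_apply i).comp ((measurable_mulVec M).comp (measurable_col j))

theorem IsSampledFrom.map_mul_left {ν : Measure (Fin N → ℤ_[p])} [IsProbabilityMeasure ν]
    (hν : ∀ c : Fin N → ℤ_[p], Measure.map (fun x => c + x) ν = ν)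
    {μ : Measure (Matrix (Fin N) (Fin N) ℤ_[p])} (hμ : IsSampledFrom ν μ)
    (U : (Matrix (Fin N) (Fin N) ℤ_[p])ˣ) :
    IsSampledFrom ν (Measure.map (fun A => U.val * A) μ) := by
  intro i B hB C hC
  let e : ({j : Fin N // i < j} → Fin N → ℤ_[p]) ≃ᵐ ({j : Fin N // i < j} → Fin N → ℤ_[p]) :=
    MeasurableEquiv.piCongrRight fun _ => mulVecEquiv U
  have hlater : laterCols p N i ∘ (fun A => U.val * A) = e ∘ laterCols p N i := rfl
  have hset : MeasurableSet {A : Matrix (Fin N) (Fin N) ℤ_[p] |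
      (fun k => A k i) ∈ B ∧ laterCols p N i A ∈ C} :=
    (measurable_col i hB).inter (measurable_laterCols i hC)
  rw [Measure.map_apply (measurable_mul_left _) hset,
    Measure.map_map (measurable_laterCols i) (measurable_mul_left _), hlater,
    ← Measure.map_map e.measurable (measurable_laterCols i), e.restrict_map, lintegral_map_equiv]
  refine (hμ i _ ((mulVecEquiv U).measurable hB) _ (e.measurable hC)).trans ?_
  exact lintegral_congr fun w => (cond_avoidSpan_mulVec hν U w hB).symm

/-- Replace the columns with index less than `m` by zero. -/
def truncate (m : ℕ) (A : Matrix (Fin N) (Fin N) ℤ_[p]) : Matrix (Fin N) (Fin N) ℤ_[p] :=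
  fun a j => if m ≤ j.val then A a j else 0

theorem measurable_truncate (m : ℕ) :
    Measurable (truncate m : Matrix (Fin N) (Fin N) ℤ_[p] → _) :=
  measurable_of_entries fun i j => by
    unfold truncate
    split_ifs
    · exact measurable_entry i j
    · exact measurable_const

theorem laterCols_truncate (i : Fin N) :
    laterCols p N i ∘ truncate (i.val + 1) = laterCols p N i := by
  funext A j k
  exact if_pos (Nat.succ_le_of_lt j.property)

/-- Reassemble the truncation at `i` from column `i` and the later columns. -/
def assemble (i : Fin N) (x : (Fin N → ℤ_[p]) × ({j : Fin N // i < j} → Fin N → ℤ_[p])) :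
    Matrix (Fin N) (Fin N) ℤ_[p] :=
  fun a j => if h : i < j then x.2 ⟨j, h⟩ a else if i = j then x.1 a else 0

theorem measurable_assemble (i : Fin N) :
    Measurable (assemble i : (Fin N → ℤ_[p]) × _ → _) :=
  measurable_of_entries fun a j => by
    unfold assemble
    split_ifs <;> fun_prop

theorem assemble_comp (i : Fin N) :
    (assemble i ∘ fun A : Matrix (Fin N) (Fin N) ℤ_[p] =>
      ((fun k => A k i), laterCols p N i A)) = truncate i.val := by
  funext A a j
  rcases lt_trichotomy i j with h | rfl | h
  · simp [assemble, truncate, laterCols, h, h.le]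
  · simp [assemble, truncate]
  · simp [assemble, truncate, h.not_gt, h.ne', h]

theorem IsSampledFrom.eq {ν : Measure (Fin N → ℤ_[p])}
    {μ μ' : Measure (Matrix (Fin N) (Fin N) ℤ_[p])}
    [IsProbabilityMeasure μ] [IsProbabilityMeasure μ']
    (hμ : IsSampledFrom ν μ) (hμ' : IsSampledFrom ν μ') : μ = μ' := by
  have key : ∀ m ≤ N, Measure.map (truncate m) μ = Measure.map (truncate m) μ' := by
    intro m hm
    induction hm using Nat.decreasingInduction with
    | self =>
      have : (truncate N : Matrix (Fin N) (Fin N) ℤ_[p] → _) = fun _ => 0 := by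
        funext A a j
        simp [truncate]
      simp [this, Measure.map_const]
    | of_succ m hm ih =>
      let i : Fin N := ⟨m, hm⟩
      have hlater : Measure.map (laterCols p N i) μ = Measure.map (laterCols p N i) μ' := by
        rw [← laterCols_truncate i,
          ← Measure.map_map (measurable_laterCols i) (measurable_truncate _),
          ← Measure.map_map (measurable_laterCols i) (measurable_truncate _), ih]
      have hmeas : Measurable fun A : Matrix (Fin N) (Fin N) ℤ_[p] =>
          ((fun k => A k i), laterCols p N i A) :=
        (measurable_col i).prodMk (measurable_laterCols i)
      have hjoint : Measure.map (fun A : Matrix (Fin N) (Fin N) ℤ_[p] =>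
            ((fun k => A k i), laterCols p N i A)) μ =
          Measure.map (fun A => ((fun k => A k i), laterCols p N i A)) μ' := by
        have := Measure.isProbabilityMeasure_map (μ := μ) hmeas.aemeasurable
        refine Measure.ext_prod fun {B C} hB hC => ?_
        rw [Measure.map_apply hmeas (hB.prod hC), Measure.map_apply hmeas (hB.prod hC)]
        refine (hμ i B hB C hC).trans ?_
        rw [hlater]
        exact (hμ' i B hB C hC).symm
      rw [show m = i.val from rfl, ← assemble_comp i,
        ← Measure.map_map (measurable_assemble i) hmeas,
        ← Measure.map_map (measurable_assemble i) hmeas, hjoint]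
  have htrunc : (truncate 0 : Matrix (Fin N) (Fin N) ℤ_[p] → _) = id := by
    funext A a j
    simp [truncate]
  simpa [htrunc] using key 0 (Nat.zero_le _)

theorem isUnit_iff_toZMod_ne_zero (x : ℤ_[p]) : IsUnit x ↔ PadicInt.toZMod x ≠ 0 := by
  rw [← IsLocalRing.notMem_maximalIdeal, ← PadicInt.ker_toZMod, RingHom.mem_ker]

theorem measurableSet_toZMod_fiber (r : ZMod p) :
    MeasurableSet {x : ℤ_[p] | PadicInt.toZMod x = r} := by
  obtain ⟨c, rfl⟩ := ZMod.ringHom_surjective (PadicInt.toZMod (p := p)) r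
  have : {x : ℤ_[p] | PadicInt.toZMod x = PadicInt.toZMod c} = Metric.ball c 1 := by
    ext x
    rw [Set.mem_ofPred_eq, mem_ball_iff_norm, ← sub_eq_zero, ← map_sub, ← PadicInt.mem_nonunits,
      mem_nonunits_iff, isUnit_iff_toZMod_ne_zero, not_not]
  rw [this]
  exact Metric.isOpen_ball.measurableSet

theorem measurableSet_reduce_fiber (r : Fin N → ZMod p) :
    MeasurableSet {x : Fin N → ℤ_[p] | reduce x = r} := by
  simp only [funext_iff, Set.ofPred_forall]
  exact MeasurableSet.iInter fun k => (measurableSet_toZMod_fiber (r k)).preimage (measurable_pi_apply k)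

theorem measurableSet_preimage_reduce (s : Set (Fin N → ZMod p)) :
    MeasurableSet (reduce ⁻¹' s : Set (Fin N → ℤ_[p])) := by
  rw [← Set.biUnion_preimage_singleton]
  exact MeasurableSet.biUnion s.to_countable fun r _ => measurableSet_reduce_fiber r

theorem IsSampledFrom.ae_mem_avoidSpan {ν : Measure (Fin N → ℤ_[p])}
    {μ : Measure (Matrix (Fin N) (Fin N) ℤ_[p])} (hμ : IsSampledFrom ν μ) (i : Fin N) :
    ∀ᵐ A ∂μ, (fun k => A k i) ∈ avoidSpan p N (laterCols p N i A) := by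
  have hfiber (r : {j : Fin N // i < j} → Fin N → ZMod p) : ∀ᵐ A ∂μ,
      (fun j => reduce (laterCols p N i A j)) = r →
        (fun k => A k i) ∈ avoidSpan p N (laterCols p N i A) := by
    let S : Set (Fin N → ℤ_[p]) := reduce ⁻¹' (Submodule.span (ZMod p) (Set.range r))
    let C : Set ({j : Fin N // i < j} → Fin N → ℤ_[p]) := {w | (fun j => reduce (w j)) = r}
    have hS : MeasurableSet S := measurableSet_preimage_reduce _
    have hC : MeasurableSet C := by
      simp only [C, funext_iff (f := fun j => reduce _), Set.ofPred_forall]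
      exact MeasurableSet.iInter fun j =>
        (measurableSet_reduce_fiber (r j)).preimage (measurable_pi_apply j)
    have hzero : μ {A | (fun k => A k i) ∈ S ∧ laterCols p N i A ∈ C} = 0 := by
      rw [hμ i S hS C hC, ← lintegral_zero]
      refine setLIntegral_congr_fun hC fun w hw => ?_
      have : avoidSpan p N w = Sᶜ := by
        ext x
        rw [mem_avoidSpan, show (fun j => reduce (w j)) = r from hw]
        rfl
      simp [this, cond_apply' hS]
    refine measure_mono_null (fun A hA => ?_) hzero
    simp only [Set.mem_compl_iff, Set.mem_ofPred_eq, Classical.not_imp, mem_avoidSpan,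
      not_not] at hA
    obtain ⟨hr, hmem⟩ := hA
    refine ⟨?_, hr⟩
    rw [hr] at hmem
    exact hmem
  filter_upwards [ae_all_iff.2 hfiber] with A hA using hA _ rfl

/-- A square matrix over a field none of whose columns is in the span of the later ones is
nonsingular. -/
theorem det_ne_zero_of_col_notMem_span {K : Type*} [Field K] (A : Matrix (Fin N) (Fin N) K)
    (h : ∀ i, A.col i ∉ Submodule.span K (Set.range fun j : {j // i < j} => A.col j)) :
    A.det ≠ 0 := by
  classical
  intro hdet
  obtain ⟨v, hv, hAv⟩ := Matrix.exists_mulVec_eq_zero_iff.2 hdet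
  have hne : (Finset.univ.filter fun i => v i ≠ 0).Nonempty := by
    obtain ⟨i, hi⟩ := Function.ne_iff.1 hv
    exact ⟨i, by simpa using hi⟩
  obtain ⟨i, hi, hmin⟩ := Finset.exists_min_image _ id hne
  simp only [Finset.mem_filter, Finset.mem_univ, true_and, id] at hi hmin
  refine h i ((Submodule.smul_mem_iff _ hi).1 ?_)
  have hsum : v i • A.col i + ∑ j ∈ Finset.univ.erase i, v j • A.col j = 0 := by
    rw [Finset.add_sum_erase _ (fun j => v j • A.col j) (Finset.mem_univ i), ← hAv]
    funext k
    simp [Matrix.mulVec, dotProduct, mul_comm]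
  rw [eq_neg_of_add_eq_zero_left hsum]
  refine Submodule.neg_mem _ (Submodule.sum_mem _ fun j hj => ?_)
  by_cases hvj : v j = 0
  · simp [hvj]
  · exact Submodule.smul_mem _ _ (Submodule.subset_span
      ⟨⟨j, lt_of_le_of_ne (hmin j hvj) (Finset.ne_of_mem_erase hj).symm⟩, rfl⟩)

theorem isUnit_det_of_col_mem_avoidSpan (A : Matrix (Fin N) (Fin N) ℤ_[p])
    (h : ∀ i, (fun k => A k i) ∈ avoidSpan p N (laterCols p N i A)) : IsUnit A.det := by
  rw [isUnit_iff_toZMod_ne_zero, RingHom.map_det]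
  exact det_ne_zero_of_col_notMem_span _ h

end HaarSampling

theorem statement3 (p : ℕ) [Fact p.Prime] (N : ℕ)
    -- the additive Haar probability measure on `ℤ_p^N`, characterized as the
    -- translation-invariant probability measure:
    (haarVec : Measure (Fin N → ℤ_[p])) (hhaarProb : IsProbabilityMeasure haarVec)
    (hhaarInv : ∀ c : Fin N → ℤ_[p], Measure.map (fun x => c + x) haarVec = haarVec)
    -- the law of the random matrix `A`:
    (μ : Measure (Matrix (Fin N) (Fin N) ℤ_[p])) (hμ : IsProbabilityMeasure μ)
    -- the sequential conditional-sampling hypothesis: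
    (hcols : ∀ i : Fin N, ∀ B : Set (Fin N → ℤ_[p]), MeasurableSet B →
      ∀ C : Set ({j : Fin N // i < j} → Fin N → ℤ_[p]), MeasurableSet C →
      μ {A | (fun k => A k i) ∈ B ∧ laterCols p N i A ∈ C} =
        ∫⁻ w in C, ProbabilityTheory.cond haarVec (avoidSpan p N w) B
          ∂(Measure.map (laterCols p N i) μ)) :
    (∀ U : (Matrix (Fin N) (Fin N) ℤ_[p])ˣ,
      Measure.map (fun A => U.val * A) μ = μ)
    ∧ μ {A | IsUnit A.det} = 1 := by
  have hsampled : HaarSampling.IsSampledFrom haarVec μ := hcols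
  refine ⟨fun U => ?_, ?_⟩
  · have := Measure.isProbabilityMeasure_map (μ := μ)
      (HaarSampling.measurable_mul_left U.val).aemeasurable
    exact (hsampled.map_mul_left hhaarInv U).eq hsampled
  · have hunit : ∀ᵐ A ∂μ, IsUnit A.det := by
      filter_upwards [ae_all_iff.2 hsampled.ae_mem_avoidSpan] with A hA
      exact HaarSampling.isUnit_det_of_col_mem_avoidSpan A hA
    rw [measure_congr (Filter.eventuallyEq_univ.2 hunit), measure_univ]
end
end

section
/- Let q be a prime power, and let d ≥ 0 and n ≥ k ≥ 0 be integers. Let B be uniformly distributed on the set of full-rank (rank k) matrices in Mat_{(n+d)×k}(𝔽_q), and let B' ∈ Mat_{n×k}(𝔽_q) be the lower (bottom) n×k submatrix of B. Then for every 0 ≤ r ≤ k, Pr(rank(B') = r) = q^{−(n−r)(k−r)} · [d choose k−r]_{q^{−1}} · [n choose r]_{q^{−1}} / [n+d choose k]_{q^{−1}}. -/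
/-!
Statement 16: if `B` is uniformly distributed on the full-rank matrices in
`Mat_{(n+d)×k}(𝔽_q)` (with `k ≤ n`) and `B'` is its bottom `n × k` submatrix, then
`Pr(rank B' = r) = q^{-(n-r)(k-r)} · [d choose k-r]_{q⁻¹} [n choose r]_{q⁻¹} / [n+d choose k]_{q⁻¹}`.
The probability is expressed as a ratio of cardinalities, and a prime power `q` is
encoded as the cardinality of a finite field `F`.
-/

noncomputable section

/-- The `t`-Pochhammer symbol `(t;t)_n = ∏_{i=1}^n (1 - tⁱ)`. -/
def tPoch (t : ℝ) (n : ℕ) : ℝ := ∏ i ∈ Finset.range n, (1 - t ^ (i + 1))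

/-- The `t`-binomial coefficient `[a choose b]_t`. -/
def tBinom (t : ℝ) (a b : ℕ) : ℝ :=
  if b ≤ a then tPoch t a / (tPoch t b * tPoch t (a - b)) else 0

open Module Submodule

section Counting

variable {K V W : Type*} [Field K] [Fintype K] [AddCommGroup V] [Module K V] [Finite V]
  [AddCommGroup W] [Module K W] [Finite W]

/-- The number of linearly independent `k`-tuples in `V` whose image under `f` has rank `r`. -/
def liCount (f : V →ₗ[K] W) (k r : ℕ) : ℕ :=
  Nat.card {s : Fin k → V //
    LinearIndependent K s ∧ finrank K (span K (Set.range (f ∘ s))) = r}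

omit [Finite W] in
lemma card_mem_not_mem_submodule {A B : Submodule K V} (h : A ≤ B) :
    (Nat.card {v : V // v ∉ A ∧ v ∈ B} : ℝ) =
      (Fintype.card K : ℝ) ^ finrank K B - (Fintype.card K : ℝ) ^ finrank K A := by
  have hA : Nat.card A = Fintype.card K ^ finrank K A := by
    rw [natCard_eq_pow_finrank (K := K), Nat.card_eq_fintype_card]
  have hB : Nat.card B = Fintype.card K ^ finrank K B := by
    rw [natCard_eq_pow_finrank (K := K), Nat.card_eq_fintype_card]
  have h1 := Set.ncard_sdiff_add_ncard_of_subset (s := (A : Set V)) (t := (B : Set V)) h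
    (Set.toFinite _)
  have h2 : ((B : Set V) \ A).ncard = Nat.card {v : V // v ∉ A ∧ v ∈ B} := by
    rw [← Nat.card_coe_set_eq]
    exact Nat.card_congr (Equiv.subtypeEquivRight fun v => by simp [and_comm])
  rw [h2, ← Nat.card_coe_set_eq, ← Nat.card_coe_set_eq] at h1
  change _ + Nat.card A = Nat.card B at h1
  rw [hA, hB] at h1
  rw [eq_sub_iff_add_eq]
  exact_mod_cast h1

omit [Fintype K] in
lemma finrank_comap_add_finrank {f : V →ₗ[K] W} (hf : Function.Surjective f)
    (S : Submodule K W) :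
    finrank K (S.comap f) + finrank K W = finrank K V + finrank K S := by
  have h1 := (S.mkQ ∘ₗ f).finrank_range_add_finrank_ker
  rw [LinearMap.ker_comp, ker_mkQ, LinearMap.range_eq_top.2
    (by simpa using (mkQ_surjective S).comp hf), finrank_top] at h1
  have h2 := S.finrank_quotient_add_finrank
  omega

omit [Fintype K] [Finite V] [Finite W] in
lemma span_range_comp_cons {k : ℕ} (f : V →ₗ[K] W) (v : V) (s : Fin k → V) :
    span K (Set.range (f ∘ (Fin.cons v s : Fin (k + 1) → V))) =
      span K (Set.range (f ∘ s)) ⊔ span K {f v} := by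
  have : f ∘ (Fin.cons v s : Fin (k + 1) → V) = Fin.cons (f v) (f ∘ s) := by
    ext i
    refine Fin.cases ?_ (fun i => ?_) i <;> simp
  rw [this, Fin.range_cons, span_insert, sup_comm]

lemma card_extensions {d n k : ℕ} {f : V →ₗ[K] W} (hf : Function.Surjective f)
    (hW : finrank K W = n) (hV : finrank K V = n + d) {s : Fin k → V}
    (hs : LinearIndependent K s) (r : ℕ) :
    (Nat.card {v : V // v ∉ span K (Set.range s) ∧
        finrank K (span K (Set.range (f ∘ (Fin.cons v s : Fin (k + 1) → V)))) = r} : ℝ) =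
      (if finrank K (span K (Set.range (f ∘ s))) = r
        then (Fintype.card K : ℝ) ^ (r + d) - (Fintype.card K : ℝ) ^ k else 0) +
      (if finrank K (span K (Set.range (f ∘ s))) + 1 = r
        then (Fintype.card K : ℝ) ^ (n + d) - (Fintype.card K : ℝ) ^ (r - 1 + d) else 0) := by
  set S := span K (Set.range (f ∘ s)) with hS
  set U := span K (Set.range s) with hU
  have hUS : U ≤ S.comap f := by
    rw [← map_le_iff_le_comap, hU, hS, map_span, Set.range_comp]
  have hUk : finrank K U = k := by rw [hU, finrank_span_eq_card hs, Fintype.card_fin]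
  have hc := finrank_comap_add_finrank hf S
  have hmem (v : V) (hv : v ∈ S.comap f) :
      finrank K (span K (Set.range (f ∘ (Fin.cons v s : Fin (k + 1) → V)))) = finrank K S := by
    rw [span_range_comp_cons, sup_eq_left.2]
    simpa using hv
  have hnmem (v : V) (hv : v ∉ S.comap f) :
      finrank K (span K (Set.range (f ∘ (Fin.cons v s : Fin (k + 1) → V)))) =
        finrank K S + 1 := by
    rw [span_range_comp_cons, finrank_sup_span_singleton]
    simpa using hv
  by_cases h1 : finrank K S = r
  · rw [if_pos h1, if_neg (by omega), add_zero,
      show (Fintype.card K : ℝ) ^ k = (Fintype.card K : ℝ) ^ finrank K U by rw [hUk],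
      show r + d = finrank K (S.comap f) by omega, ← card_mem_not_mem_submodule hUS]
    congr 1
    refine Nat.card_congr (Equiv.subtypeEquivRight fun v => and_congr_right fun _ => ?_)
    by_cases hv : v ∈ S.comap f
    · simp only [hmem v hv, h1, hv]
    · simp only [hnmem v hv, h1, hv, iff_false]
      omega
  · by_cases h2 : finrank K S + 1 = r
    · have htop := card_mem_not_mem_submodule (K := K) (le_top : S.comap f ≤ ⊤)
      rw [finrank_top, hV] at htop
      rw [if_neg h1, if_pos h2, zero_add,
        show r - 1 + d = finrank K (S.comap f) by omega, ← htop]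
      congr 1
      refine Nat.card_congr (Equiv.subtypeEquivRight fun v => ?_)
      by_cases hv : v ∈ S.comap f
      · simp only [hmem v hv, h1, hv]
        simp
      · simp only [hnmem v hv, h2, hv]
        simpa using fun h => hv (hUS h)
    · rw [if_neg h1, if_neg h2, add_zero, Nat.cast_eq_zero]
      have : IsEmpty {v : V // v ∉ U ∧
          finrank K (span K (Set.range (f ∘ (Fin.cons v s : Fin (k + 1) → V)))) = r} := by
        refine ⟨fun ⟨v, _, hv⟩ => ?_⟩
        by_cases hv' : v ∈ S.comap f
        · exact h1 (hmem v hv' ▸ hv)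
        · exact h2 (hnmem v hv' ▸ hv)
      exact Nat.card_of_isEmpty

omit [Fintype K] [Finite V] [Finite W] in
/-- A linearly independent `k + 1`-tuple is a linearly independent `k`-tuple together with a
vector outside its span. -/
def liConsEquiv (f : V →ₗ[K] W) (k r : ℕ) :
    {s : Fin (k + 1) → V //
      LinearIndependent K s ∧ finrank K (span K (Set.range (f ∘ s))) = r} ≃
    Σ s : {s : Fin k → V // LinearIndependent K s},
      {v : V // v ∉ span K (Set.range (s : Fin k → V)) ∧
        finrank K (span K (Set.range (f ∘ (Fin.cons v s.1 : Fin (k + 1) → V)))) = r} where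
  toFun s := ⟨⟨Fin.tail s.1, (linearIndependent_finSucc.1 s.2.1).1⟩,
    ⟨s.1 0, (linearIndependent_finSucc.1 s.2.1).2, 
      (congrArg (fun t : Fin (k + 1) → V => finrank K (span K (Set.range (f ∘ t))))
        (Fin.cons_self_tail s.1)).trans s.2.2⟩⟩
  invFun s := ⟨Fin.cons s.2.1 s.1.1, linearIndependent_finCons.2 ⟨s.1.2, s.2.2.1⟩, s.2.2.2⟩
  left_inv _ := by simp
  right_inv := fun ⟨⟨_, _⟩, ⟨_, _⟩⟩ => rfl

open Classical in
omit [Fintype K] [Finite V] [Finite W] in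
lemma liCount_eq_sum {k : ℕ} [Fintype {s : Fin k → V // LinearIndependent K s}]
    (f : V →ₗ[K] W) (r : ℕ) :
    (liCount f k r : ℝ) = ∑ s : {s : Fin k → V // LinearIndependent K s},
      if finrank K (span K (Set.range (f ∘ s.1))) = r then 1 else 0 := by
  rw [Finset.sum_boole, liCount, ← Fintype.card_subtype, ← Nat.card_eq_fintype_card]
  congr 1
  exact Nat.card_congr (Equiv.subtypeSubtypeEquivSubtypeInter _ _).symm

open Classical in
lemma liCount_succ_eq_sum {d n k : ℕ} [Fintype {s : Fin k → V // LinearIndependent K s}]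
    {f : V →ₗ[K] W} (hf : Function.Surjective f)
    (hW : finrank K W = n) (hV : finrank K V = n + d) (r : ℕ) :
    (liCount f (k + 1) r : ℝ) =
      ((Fintype.card K : ℝ) ^ (r + d) - (Fintype.card K : ℝ) ^ k) * liCount f k r +
      ((Fintype.card K : ℝ) ^ (n + d) - (Fintype.card K : ℝ) ^ (r - 1 + d)) *
        ∑ s : {s : Fin k → V // LinearIndependent K s},
          if finrank K (span K (Set.range (f ∘ s.1))) + 1 = r then 1 else 0 := by
  rw [liCount, Nat.card_congr (liConsEquiv f k r), Nat.card_sigma, Nat.cast_sum,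
    liCount_eq_sum, Finset.mul_sum, Finset.mul_sum, ← Finset.sum_add_distrib]
  refine Finset.sum_congr rfl fun s _ => ?_
  rw [card_extensions hf hW hV s.2 r]
  simp only [mul_ite, mul_one, mul_zero]

lemma liCount_succ_zero {d n : ℕ} (k : ℕ) {f : V →ₗ[K] W} (hf : Function.Surjective f)
    (hW : finrank K W = n) (hV : finrank K V = n + d) :
    (liCount f (k + 1) 0 : ℝ) =
      ((Fintype.card K : ℝ) ^ d - (Fintype.card K : ℝ) ^ k) * liCount f k 0 := by
  have := Fintype.ofFinite {s : Fin k → V // LinearIndependent K s}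
  rw [liCount_succ_eq_sum hf hW hV]
  simp

lemma liCount_succ_succ {d n : ℕ} (k r : ℕ) {f : V →ₗ[K] W} (hf : Function.Surjective f)
    (hW : finrank K W = n) (hV : finrank K V = n + d) :
    (liCount f (k + 1) (r + 1) : ℝ) =
      ((Fintype.card K : ℝ) ^ (r + 1 + d) - (Fintype.card K : ℝ) ^ k) * liCount f k (r + 1) +
      ((Fintype.card K : ℝ) ^ (n + d) - (Fintype.card K : ℝ) ^ (r + d)) * liCount f k r := by
  have := Fintype.ofFinite {s : Fin k → V // LinearIndependent K s}
  rw [liCount_succ_eq_sum hf hW hV, liCount_eq_sum f r]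
  simp

omit [Fintype K] [Finite V] [Finite W] in
lemma liCount_eq_zero_of_lt (f : V →ₗ[K] W) {k r : ℕ} (h : k < r) : liCount f k r = 0 := by
  have : IsEmpty {s : Fin k → V //
      LinearIndependent K s ∧ finrank K (span K (Set.range (f ∘ s))) = r} := by
    refine ⟨fun ⟨s, _, hs⟩ => ?_⟩
    have := finrank_range_le_card (R := K) (f ∘ s)
    rw [Set.finrank, hs, Fintype.card_fin] at this
    omega
  exact Nat.card_of_isEmpty

omit [Fintype K] [Finite V] [Finite W] in
lemma liCount_zero_zero (f : V →ₗ[K] W) : liCount f 0 0 = 1 := by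
  rw [liCount, Nat.card_eq_one_iff_unique]
  refine ⟨inferInstance, ⟨⟨Fin.elim0, linearIndependent_empty_type, ?_⟩⟩⟩
  rw [Set.range_eq_empty, span_empty, finrank_bot]

end Counting

section TBinomial

lemma tPoch_succ (t : ℝ) (n : ℕ) : tPoch t (n + 1) = tPoch t n * (1 - t ^ (n + 1)) :=
  Finset.prod_range_succ _ _

lemma tPoch_zero (t : ℝ) : tPoch t 0 = 1 := Finset.prod_range_zero _

lemma one_sub_pow_succ_ne_zero {t : ℝ} (h0 : 0 ≤ t) (h1 : t < 1) (n : ℕ) :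
    1 - t ^ (n + 1) ≠ 0 :=
  (sub_pos.2 (pow_lt_one₀ h0 h1 n.succ_ne_zero)).ne'

lemma tPoch_ne_zero {t : ℝ} (h0 : 0 ≤ t) (h1 : t < 1) (n : ℕ) : tPoch t n ≠ 0 :=
  Finset.prod_ne_zero_iff.2 fun i _ => one_sub_pow_succ_ne_zero h0 h1 i

lemma tBinom_zero_right {t : ℝ} (h0 : 0 ≤ t) (h1 : t < 1) (n : ℕ) : tBinom t n 0 = 1 := by
  simp [tBinom, tPoch_zero, tPoch_ne_zero h0 h1]

lemma tBinom_eq_zero_of_lt (t : ℝ) {a b : ℕ} (h : a < b) : tBinom t a b = 0 :=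
  if_neg (by omega)

lemma tBinom_succ_mul {t : ℝ} (h0 : 0 ≤ t) (h1 : t < 1) (a b : ℕ) :
    tBinom t a (b + 1) * (1 - t ^ (b + 1)) = tBinom t a b * (1 - t ^ (a - b)) := by
  rcases lt_trichotomy a b with h | rfl | h
  · rw [tBinom_eq_zero_of_lt t h, tBinom_eq_zero_of_lt t (by omega)]
    simp
  · rw [tBinom_eq_zero_of_lt t (Nat.lt_succ_self a)]
    simp
  · obtain ⟨c, rfl⟩ := Nat.exists_eq_add_of_lt h
    have e1 : b + c + 1 - (b + 1) = c := by omega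
    have e2 : b + c + 1 - b = c + 1 := by omega
    rw [tBinom, tBinom, if_pos (by omega), if_pos (by omega), e1, e2, tPoch_succ t b,
      tPoch_succ t c]
    have := tPoch_ne_zero h0 h1 b
    have := tPoch_ne_zero h0 h1 c
    have := one_sub_pow_succ_ne_zero h0 h1 b
    have := one_sub_pow_succ_ne_zero h0 h1 c
    field_simp

lemma tBinom_ne_zero {t : ℝ} (h0 : 0 ≤ t) (h1 : t < 1) {a b : ℕ} (h : b ≤ a) :
    tBinom t a b ≠ 0 := by
  rw [tBinom, if_pos h]
  exact div_ne_zero (tPoch_ne_zero h0 h1 _)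
    (mul_ne_zero (tPoch_ne_zero h0 h1 _) (tPoch_ne_zero h0 h1 _))

/-- Closed form for the number of linearly independent `r + s`-tuples in an
`n + d`-dimensional space whose image in an `n`-dimensional quotient has rank `r`. -/
def liClosedForm (Q : ℝ) (n d r s : ℕ) : ℝ :=
  Q ^ ((n + d) * (r + s)) * Q⁻¹ ^ ((n - r) * s) * tPoch Q⁻¹ (r + s) *
    (tBinom Q⁻¹ d s * tBinom Q⁻¹ n r)

/-- `[d choose s]` annihilates the case `d < s`, so `Q ^ d - Q ^ s` may be factored freely. -/
lemma pow_sub_pow_mul_tBinom {Q : ℝ} (hQ : 1 < Q) (d s : ℕ) :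
    (Q ^ d - Q ^ s) * tBinom Q⁻¹ d s =
      Q ^ d * (1 - Q⁻¹ ^ (s + 1)) * tBinom Q⁻¹ d (s + 1) := by
  have hQ0 : Q ≠ 0 := by positivity
  have key := tBinom_succ_mul (inv_nonneg.2 (by linarith)) (inv_lt_one_of_one_lt₀ hQ) d s
  rcases lt_or_ge d s with h | h
  · rw [tBinom_eq_zero_of_lt _ h, tBinom_eq_zero_of_lt _ (by omega)]
    simp
  · have : Q ^ d - Q ^ s = Q ^ d * (1 - Q⁻¹ ^ (d - s)) := by
      obtain ⟨c, rfl⟩ := Nat.exists_eq_add_of_le h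
      rw [Nat.add_sub_cancel_left, inv_pow, pow_add]
      field_simp
    rw [this]
    linear_combination -Q ^ d * key

lemma liClosedForm_zero_succ {Q : ℝ} (hQ : 1 < Q) (n d s : ℕ) :
    liClosedForm Q n d 0 (s + 1) = (Q ^ d - Q ^ s) * liClosedForm Q n d 0 s := by
  have hQ0 : Q ≠ 0 := by positivity
  have key := pow_sub_pow_mul_tBinom hQ d s
  have e : Q ^ ((n + d) * (0 + (s + 1))) * Q⁻¹ ^ ((n - 0) * (s + 1)) =
      Q ^ d * (Q ^ ((n + d) * (0 + s)) * Q⁻¹ ^ ((n - 0) * s)) := by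
    simp only [inv_pow, Nat.sub_zero, zero_add]
    field_simp
    ring
  rw [liClosedForm, liClosedForm, e, ← add_assoc, tPoch_succ, zero_add]
  linear_combination (-(Q ^ ((n + d) * s) * Q⁻¹ ^ ((n - 0) * s)) * tPoch Q⁻¹ s *
    tBinom Q⁻¹ n 0) * key

lemma liClosedForm_succ_zero {Q : ℝ} (hQ : 1 < Q) (n d r : ℕ) :
    liClosedForm Q n d (r + 1) 0 = (Q ^ (n + d) - Q ^ (r + d)) * liClosedForm Q n d r 0 := by
  have key := pow_sub_pow_mul_tBinom hQ n r
  simp only [liClosedForm, add_zero, mul_zero, pow_zero, tPoch_succ, mul_add, mul_one, pow_add]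
  linear_combination (-(Q ^ d * Q ^ (n * r) * Q ^ (d * r)) * tPoch Q⁻¹ r * tBinom Q⁻¹ d 0) * key

lemma liClosedForm_succ_succ {Q : ℝ} (hQ : 1 < Q) (n d r s : ℕ) :
    liClosedForm Q n d (r + 1) (s + 1) =
      (Q ^ (r + 1 + d) - Q ^ (r + 1 + s)) * liClosedForm Q n d (r + 1) s +
      (Q ^ (n + d) - Q ^ (r + d)) * liClosedForm Q n d r (s + 1) := by
  have hQ0 : Q ≠ 0 := by positivity
  have key1 := pow_sub_pow_mul_tBinom hQ d s
  have key2 := pow_sub_pow_mul_tBinom hQ n r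
  rcases lt_or_ge r n with h | h
  · obtain ⟨c, rfl⟩ := Nat.exists_eq_add_of_lt h
    have e1 : r + c + 1 - (r + 1) = c := by omega
    have e2 : r + c + 1 - r = c + 1 := by omega
    rw [liClosedForm, liClosedForm, liClosedForm, e1, e2,
      show r + 1 + (s + 1) = r + s + 1 + 1 by ring, show r + 1 + s = r + s + 1 by ring,
      show r + (s + 1) = r + s + 1 by ring, tPoch_succ _ (r + s + 1)]
    set P := tPoch Q⁻¹ (r + s + 1)
    set E := Q ^ ((r + c + 1 + d) * (r + s + 1))
    have a1 : Q ^ ((r + c + 1 + d) * (r + s + 1 + 1)) = E * Q ^ (r + c + 1 + d) := by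
      rw [mul_add _ _ 1, pow_add, mul_one]
    have a2 : Q ^ (r + 1 + d) - Q ^ (r + s + 1) = Q ^ (r + 1) * (Q ^ d - Q ^ s) := by ring
    have a3 : Q ^ (r + c + 1 + d) - Q ^ (r + d) = Q ^ d * (Q ^ (r + c + 1) - Q ^ r) := by ring
    have a4 : Q ^ (r + c + 1 + d) = Q ^ (r + 1) * Q ^ c * Q ^ d := by ring
    have a5 : Q⁻¹ ^ (c * (s + 1)) = Q⁻¹ ^ (c * s) * (Q⁻¹) ^ c := by ring
    have a6 : Q⁻¹ ^ ((c + 1) * (s + 1)) = Q⁻¹ ^ (c * s) * Q⁻¹ ^ c * Q⁻¹ ^ (s + 1) := by ring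
    have a7 : Q ^ c * Q⁻¹ ^ c = 1 := by rw [← mul_pow, mul_inv_cancel₀ hQ0, one_pow]
    have a8 : Q ^ (r + c + 1) = Q ^ (r + 1) * Q ^ c := by ring
    have a9 : Q⁻¹ ^ (r + s + 1 + 1) = Q⁻¹ ^ (r + 1) * Q⁻¹ ^ (s + 1) := by ring
    rw [a1, a2, a3, a4, a5, a6, a8, a9]
    clear_value E P
    rw [a8] at key2
    generalize Q⁻¹ ^ (c * s) = X at *
    generalize tBinom Q⁻¹ (r + c + 1) r = B0 at *
    generalize tBinom Q⁻¹ (r + c + 1) (r + 1) = B1 at *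
    generalize tBinom Q⁻¹ d s = D0 at *
    generalize tBinom Q⁻¹ d (s + 1) = D1 at *
    generalize Q⁻¹ ^ c = c' at *
    generalize Q⁻¹ ^ (s + 1) = s' at *
    generalize Q⁻¹ ^ (r + 1) = r' at *
    generalize Q ^ (r + 1) = R1 at *
    generalize Q ^ c = C at *
    linear_combination (-(E * X * P * B1 * R1)) * key1 -
      (E * X * c' * s' * P * D1 * Q ^ d) * key2 +
      (E * X * P * B1 * D1 * R1 * Q ^ d * (1 - s')) * a7
  · have z : tBinom Q⁻¹ n (r + 1) = 0 := tBinom_eq_zero_of_lt _ (by omega)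
    rw [z, mul_zero] at key2
    simp only [liClosedForm, z, pow_add _ _ d]
    linear_combination (-(Q ^ d * (Q ^ ((n + d) * (r + (s + 1))) * Q⁻¹ ^ ((n - r) * (s + 1)) *
      tPoch Q⁻¹ (r + (s + 1)) * tBinom Q⁻¹ d (s + 1)))) * key2

end TBinomial

lemma liCount_eq_liClosedForm {K V W : Type*} [Field K] [Fintype K] [AddCommGroup V]
    [Module K V] [Finite V] [AddCommGroup W] [Module K W] [Finite W] {d n : ℕ}
    {f : V →ₗ[K] W} (hf : Function.Surjective f) (hW : finrank K W = n)
    (hV : finrank K V = n + d) (r s : ℕ) :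
    (liCount f (r + s) r : ℝ) = liClosedForm (Fintype.card K) n d r s := by
  have hQ : (1 : ℝ) < Fintype.card K := by exact_mod_cast Fintype.one_lt_card
  have h0 : (0 : ℝ) ≤ (Fintype.card K : ℝ)⁻¹ := by positivity
  have h1 := inv_lt_one_of_one_lt₀ hQ
  induction h : r + s generalizing r s with
  | zero =>
    obtain ⟨rfl, rfl⟩ : r = 0 ∧ s = 0 := by omega
    simp [liCount_zero_zero, liClosedForm, tPoch_zero, tBinom_zero_right h0 h1]
  | succ k ih =>
    rcases r with _ | r
    · obtain rfl : s = k + 1 := by omega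
      rw [liCount_succ_zero k hf hW hV, liClosedForm_zero_succ hQ, ih 0 k (by omega)]
    · rw [liCount_succ_succ k r hf hW hV, ih r s (by omega)]
      rcases s with _ | s
      · rw [liCount_eq_zero_of_lt f (by omega), liClosedForm_succ_zero hQ]
        simp
      · rw [ih (r + 1) s (by omega), liClosedForm_succ_succ hQ,
          show k = r + 1 + s by omega]

lemma rank_eq_iff_linearIndependent_col {F : Type*} [Field F] {m k : ℕ}
    (B : Matrix (Fin m) (Fin k) F) : B.rank = k ↔ LinearIndependent F B.col := by
  rw [linearIndependent_iff_card_eq_finrank_span, Set.finrank,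
    ← Matrix.rank_eq_finrank_span_cols, Fintype.card_fin, eq_comm]

/-- Full-rank matrices whose row-submatrix along `e` has rank `r` are counted by their columns. -/
lemma card_full_rank_submatrix {F : Type*} [Field F] {m n k : ℕ} (e : Fin n → Fin m) (r : ℕ) :
    Nat.card {B : Matrix (Fin m) (Fin k) F //
        B.rank = k ∧ (Matrix.of fun (i : Fin n) (j : Fin k) => B (e i) j).rank = r} =
      liCount (LinearMap.funLeft F F e) k r := by
  refine Nat.card_congr ((Equiv.piComm _).subtypeEquiv fun B => and_congr ?_ ?_)
  · exact rank_eq_iff_linearIndependent_col B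
  · rw [Matrix.rank_eq_finrank_span_cols]
    rfl

theorem statement16 (F : Type) [Field F] [Fintype F] (q : ℕ) (hq : q = Fintype.card F)
    (d n k r : ℕ) (hkn : k ≤ n) (hrk : r ≤ k) :
    (Nat.card {B : Matrix (Fin (n + d)) (Fin k) F //
        B.rank = k ∧
          (Matrix.of fun (i : Fin n) (j : Fin k) => B ⟨d + (i : ℕ), by omega⟩ j).rank = r} : ℝ) /
      (Nat.card {B : Matrix (Fin (n + d)) (Fin k) F // B.rank = k} : ℝ) =
    ((q : ℝ)⁻¹) ^ ((n - r) * (k - r)) *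
      (tBinom (q : ℝ)⁻¹ d (k - r) * tBinom (q : ℝ)⁻¹ n r) / tBinom (q : ℝ)⁻¹ (n + d) k := by
  have hQ : (1 : ℝ) < q := by
    rw [hq]
    exact_mod_cast Fintype.one_lt_card
  have h0 : (0 : ℝ) ≤ (q : ℝ)⁻¹ := by positivity
  have h1 := inv_lt_one_of_one_lt₀ hQ
  have hnum := card_full_rank_submatrix (F := F) (k := k)
    (fun i : Fin n => (⟨d + (i : ℕ), by omega⟩ : Fin (n + d))) r
  have hden : Nat.card {B : Matrix (Fin (n + d)) (Fin k) F // B.rank = k} =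
      liCount (LinearMap.funLeft F F (id : Fin (n + d) → Fin (n + d))) k k := by
    rw [← card_full_rank_submatrix]
    exact Nat.card_congr (Equiv.subtypeEquivRight fun B => (and_self_iff).symm)
  have hnum' := liCount_eq_liClosedForm (K := F) (n := n) (d := d)
    (LinearMap.funLeft_surjective_of_injective F F
      (fun i : Fin n => (⟨d + (i : ℕ), by omega⟩ : Fin (n + d)))
      (fun i j hij => by simpa [Fin.ext_iff] using hij))
    (by simp) (by simp) r (k - r)
  have hden' := liCount_eq_liClosedForm (K := F) (n := n + d) (d := 0)
    (LinearMap.funLeft_surjective_of_injective F F (id : Fin (n + d) → Fin (n + d))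
      Function.injective_id)
    (by simp) (by simp) k 0
  rw [Nat.add_sub_cancel' hrk] at hnum'
  rw [add_zero] at hden'
  rw [hnum, hden, hnum', hden', ← hq, liClosedForm, liClosedForm, Nat.add_sub_cancel' hrk,
    tBinom_zero_right h0 h1]
  have hP := tPoch_ne_zero h0 h1 k
  have hB := tBinom_ne_zero h0 h1 (show k ≤ n + d by omega)
  have hq0 : (q : ℝ) ^ ((n + d) * k) ≠ 0 := by positivity
  simp only [add_zero, mul_zero, pow_zero, mul_one, one_mul]
  generalize (q : ℝ)⁻¹ = t at *
  field_simp
end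
end

section
/- Let q be a prime power, t := 1/q, (r_N)_{N≥1} any sequence of positive integers with r_N → ∞, and (D_N)_{N≥1} any sequence of positive integers. Let A_N be the top-left N×N submatrix of a uniformly random element of GL_{N+D_N}(𝔽_q). Then as N → ∞, Pr(corank(A_N) > r_N) = o(E[1(corank(A_N) ≤ r_N)·(t^{r_N − corank(A_N)} − t^{r_N})]). The same conclusion holds if instead A_N is uniformly distributed on Mat_N(𝔽_q). -/
/-!
Statement 18: with `t = 1/q`, `r_N → ∞`, and `A_N` the top-left `N × N` submatrix of a
uniformly random element of `GL_{N+D_N}(𝔽_q)`,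
`Pr(corank A_N > r_N) = o(E[1(corank A_N ≤ r_N)·(t^{r_N − corank A_N} − t^{r_N})])`
as `N → ∞`; the same holds for `A_N` uniform on `Mat_N(𝔽_q)`.  Probabilities and
expectations over uniform measures on finite sets are written as averages, and a prime
power `q` is encoded as the cardinality of a finite field `F`.
-/

noncomputable section

open Filter

/-- corank of the top-left `N × N` submatrix of `g ∈ GL_{N+D}(𝔽_q)`. -/
def corankTL (F : Type) [Field F] [Fintype F] (N D : ℕ)
    (g : (Matrix (Fin (N + D)) (Fin (N + D)) F)ˣ) : ℕ :=
  N - ((g : Matrix (Fin (N + D)) (Fin (N + D)) F).submatrix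
    (Fin.castLE (Nat.le_add_right N D)) (Fin.castLE (Nat.le_add_right N D)) :
      Matrix (Fin N) (Fin N) F).rank

theorem LinearIndependent.exists_linearEquiv {F V : Type*} [Field F] [AddCommGroup V] [Module F V]
    [FiniteDimensional F V] {ι : Type*} {v w : ι → V}
    (hv : LinearIndependent F v) (hw : LinearIndependent F w) :
    ∃ e : V ≃ₗ[F] V, ∀ i, e (v i) = w i := by
  obtain ⟨g, hg⟩ := Submodule.exists_linearEquiv_restrict_eq
    (hv.linearCombinationEquiv.symm ≪≫ₗ hw.linearCombinationEquiv)
  refine ⟨g, fun i => ?_⟩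
  have h1 : v i = hv.linearCombinationEquiv (Finsupp.single i 1) := by simp
  rw [h1, ← hg]
  simp

theorem LinearIndependent.exists_linearMap {F V : Type*} [Field F] [AddCommGroup V] [Module F V]
    {ι V' : Type*} [AddCommGroup V'] [Module F V']
    {v : ι → V} (hv : LinearIndependent F v) (w : ι → V') :
    ∃ f : V →ₗ[F] V', ∀ i, f (v i) = w i := by
  obtain ⟨f, hf⟩ := ((Finsupp.linearCombination F w).comp
    hv.linearCombinationEquiv.symm.toLinearMap).exists_extend
  refine ⟨f, fun i => ?_⟩
  have h1 : v i = hv.linearCombinationEquiv (Finsupp.single i 1) := by simp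
  have h2 := LinearMap.congr_fun hf (hv.linearCombinationEquiv (Finsupp.single i 1))
  rw [h1]
  simpa using h2

open Finset in
/-- The linearly independent `k`-tuples of vectors lying in the submodule `W`. -/
def independentTuples {F V : Type*} [Field F] [AddCommGroup V] [Module F V] [Fintype V]
    [DecidableEq V] (k : ℕ) (W : Submodule F V) : Finset (Fin k → V) :=
  open Classical in univ.filter fun v => LinearIndependent F v ∧ ∀ i, v i ∈ W

section Tuples

variable {F V : Type*} [Field F] [AddCommGroup V] [Module F V] [Fintype V] [DecidableEq V]

theorem mem_independentTuples {k : ℕ} {W : Submodule F V} {v : Fin k → V} :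
    v ∈ independentTuples k W ↔ LinearIndependent F v ∧ ∀ i, v i ∈ W := by
  simp [independentTuples]

theorem card_independentTuples [Fintype F] {k : ℕ} {W : Submodule F V}
    (hk : k ≤ Module.finrank F W) :
    (independentTuples k W).card =
      ∏ i : Fin k, (Fintype.card F ^ Module.finrank F W - Fintype.card F ^ i.val) := by
  rw [← card_linearIndependent (K := F) (V := W) hk, ← Nat.card_eq_finsetCard]
  refine Nat.card_congr
    { toFun := fun v => ⟨fun i => ⟨v.1 i, (mem_independentTuples.1 v.2).2 i⟩, ?_⟩
      invFun := fun w => ⟨fun i => (w.1 i : V), mem_independentTuples.2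
        ⟨w.2.map' W.subtype W.ker_subtype, fun i => (w.1 i).2⟩⟩
      left_inv := fun v => rfl
      right_inv := fun w => rfl }
  exact LinearIndependent.of_comp W.subtype (mem_independentTuples.1 v.2).1

theorem card_independentTuples_eq_zero {k : ℕ} {W : Submodule F V}
    (hk : Module.finrank F W < k) : (independentTuples k W).card = 0 := by
  rw [Finset.card_eq_zero, Finset.eq_empty_iff_forall_notMem]
  intro v hv
  rw [mem_independentTuples] at hv
  have h : LinearIndependent F (fun i => (⟨v i, hv.2 i⟩ : W)) :=
    LinearIndependent.of_comp W.subtype hv.1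
  simpa using h.fintype_card_le_finrank.trans_lt hk

theorem card_independentTuples_one [Fintype F] (W : Submodule F V) :
    ((independentTuples 1 W).card : ℝ) =
      (Fintype.card F : ℝ) ^ Module.finrank F W - 1 := by
  rcases Nat.lt_or_ge (Module.finrank F W) 1 with h | h
  · rw [card_independentTuples_eq_zero h, Nat.lt_one_iff.1 h]
    simp
  · rw [card_independentTuples h]
    simp [Nat.cast_sub (Nat.one_le_pow _ _ Fintype.card_pos)]

theorem card_independentTuples_two [Fintype F] (W : Submodule F V) :
    ((independentTuples 2 W).card : ℝ) =
      ((Fintype.card F : ℝ) ^ Module.finrank F W - 1) *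
        ((Fintype.card F : ℝ) ^ Module.finrank F W - Fintype.card F) := by
  rcases Nat.lt_or_ge (Module.finrank F W) 2 with h | h
  · rw [card_independentTuples_eq_zero h]
    interval_cases Module.finrank F W <;> simp
  · rw [card_independentTuples h, Fin.prod_univ_two]
    have h1 : Fintype.card F ≤ Fintype.card F ^ Module.finrank F W :=
      Nat.le_self_pow (by omega) _
    simp [Nat.cast_sub (Nat.one_le_pow _ _ Fintype.card_pos), Nat.cast_sub h1]

end Tuples

theorem finrank_ker_mulVecLin {F : Type*} [Field F] {N : ℕ} (M : Matrix (Fin N) (Fin N) F) :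
    Module.finrank F (LinearMap.ker M.mulVecLin) = N - M.rank := by
  have h := M.mulVecLin.finrank_range_add_finrank_ker
  rw [Module.finrank_fin_fun] at h
  rw [Matrix.rank]
  omega

section Counting

open Finset Matrix

theorem card_filter_mem_mul_card {Ω T : Type*} [Fintype Ω] [DecidableEq T] (f : Ω → T)
    {S U : Finset T} (hf : ∀ x, f x ∈ S) (hU : U ⊆ S)
    (hc : ∀ w ∈ S, ∀ w' ∈ S, #{x | f x = w} = #{x | f x = w'}) :
    #{x | f x ∈ U} * #S = #U * Fintype.card Ω := by
  rcases S.eq_empty_or_nonempty with rfl | ⟨w, hw⟩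
  · simp [Finset.subset_empty.1 hU]
  have hS : Fintype.card Ω = #S * #{x | f x = w} := by
    rw [← Finset.card_univ, card_eq_sum_card_fiberwise (f := f) (t := S) fun x _ => hf x,
      sum_congr rfl fun b hb => hc b hb w hw, sum_const, smul_eq_mul]
  have hU' : #{x | f x ∈ U} = #U * #{x | f x = w} := by
    rw [card_eq_sum_card_fiberwise (f := f) (t := U) (s := {x | f x ∈ U})
      (fun x hx => by simpa using hx), sum_congr rfl (g := fun _ => #{x | f x = w}),
      sum_const, smul_eq_mul]
    intro b hb
    rw [← hc b (hU hb) w hw]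
    congr 1
    ext x
    simp only [mem_filter, mem_univ, true_and, and_iff_right_iff_imp]
    rintro rfl
    exact hb
  rw [hS, hU']
  ring

variable {F : Type*} [Field F] [Fintype F] [DecidableEq F]

/-- For a fixed independent `k`-tuple, the proportion of matrices killing it. -/
theorem card_matrix_kernel {N k : ℕ} {v : Fin k → Fin N → F} (hv : LinearIndependent F v) :
    #{M : Matrix (Fin N) (Fin N) F | ∀ i, M *ᵥ v i = 0} * (Fintype.card F ^ N) ^ k =
      Fintype.card (Matrix (Fin N) (Fin N) F) := by
  have h := card_filter_mem_mul_card
    (fun (M : Matrix (Fin N) (Fin N) F) (i : Fin k) => M *ᵥ v i) (S := univ) (U := {0})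
    (fun _ => mem_univ _) (subset_univ _) ?_
  · simpa [funext_iff (g := (0 : Fin k → Fin N → F))] using h
  have key : ∀ w : Fin k → Fin N → F,
      #{M : Matrix (Fin N) (Fin N) F | (fun i => M *ᵥ v i) = w} =
      #{M : Matrix (Fin N) (Fin N) F | (fun i => M *ᵥ v i) = 0} := by
    intro w
    obtain ⟨f, hf⟩ := hv.exists_linearMap w
    refine card_equiv (Equiv.subRight (LinearMap.toMatrix' f)) fun M => ?_
    simp [funext_iff (α := Fin k), sub_mulVec, hf, sub_eq_zero]
  intro w _ w' _
  rw [key w, key w']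

/-- The proportion of invertible matrices sending a fixed independent `k`-tuple into `W`. -/
theorem card_units_mulVec_mem {n k : ℕ} {v : Fin k → Fin n → F} (hv : LinearIndependent F v)
    (W : Submodule F (Fin n → F)) [DecidablePred (· ∈ W)] :
    #{g : (Matrix (Fin n) (Fin n) F)ˣ | ∀ i, (g : Matrix (Fin n) (Fin n) F) *ᵥ v i ∈ W} *
        #(independentTuples k (⊤ : Submodule F (Fin n → F))) =
      #(independentTuples k W) * Fintype.card (Matrix (Fin n) (Fin n) F)ˣ := by
  have hg : ∀ g : (Matrix (Fin n) (Fin n) F)ˣ,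
      LinearIndependent F fun i => (g : Matrix (Fin n) (Fin n) F) *ᵥ v i := fun g =>
    hv.map' (mulVecLin (g : Matrix (Fin n) (Fin n) F))
      (LinearMap.ker_eq_bot.2 (mulVec_injective_of_isUnit g.isUnit))
  have h := card_filter_mem_mul_card
    (fun (g : (Matrix (Fin n) (Fin n) F)ˣ) (i : Fin k) => (g : Matrix (Fin n) (Fin n) F) *ᵥ v i)
    (S := independentTuples k ⊤) (U := independentTuples k W)
    (fun g => mem_independentTuples.2 ⟨hg g, fun _ => trivial⟩)
    (fun w hw => mem_independentTuples.2 ⟨(mem_independentTuples.1 hw).1, fun _ => trivial⟩) ?_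
  · simpa [mem_independentTuples, hg] using h
  intro w hw w' hw'
  obtain ⟨e, he⟩ := (mem_independentTuples.1 hw).1.exists_linearEquiv (mem_independentTuples.1 hw').1
  let u : (Matrix (Fin n) (Fin n) F)ˣ :=
    ⟨LinearMap.toMatrix' e.toLinearMap, LinearMap.toMatrix' e.symm.toLinearMap,
      by rw [← LinearMap.toMatrix'_comp]; simp, by rw [← LinearMap.toMatrix'_comp]; simp⟩
  have hu : ∀ x, (u : Matrix (Fin n) (Fin n) F) *ᵥ x = e x := fun x => by simp [u]
  refine card_equiv (Equiv.mulLeft u) fun g => ?_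
  simp only [mem_filter, mem_univ, true_and, funext_iff (α := Fin k), Equiv.coe_mulLeft,
    Units.val_mul, ← mulVec_mulVec, hu, ← he, e.injective.eq_iff]

/-- Double counting: the mean number of independent `k`-tuples in the kernel of `A`. -/
theorem sum_card_independentTuples_ker {Ω : Type*} [Fintype Ω] {N k a b : ℕ}
    (A : Ω → Matrix (Fin N) (Fin N) F)
    (h : ∀ v : Fin k → Fin N → F, LinearIndependent F v →
      #{x | ∀ i, A x *ᵥ v i = 0} * b = a * Fintype.card Ω) :
    (∑ x, #(independentTuples k (LinearMap.ker (A x).mulVecLin))) * b =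
      #(independentTuples k (⊤ : Submodule F (Fin N → F))) * a * Fintype.card Ω := by
  have h1 := sum_card_bipartiteAbove_eq_sum_card_bipartiteBelow (s := univ)
    (t := independentTuples k (⊤ : Submodule F (Fin N → F)))
    (fun (x : Ω) (v : Fin k → Fin N → F) => ∀ i, A x *ᵥ v i = 0)
  have h2 : ∀ x, bipartiteAbove (fun (x : Ω) (v : Fin k → Fin N → F) => ∀ i, A x *ᵥ v i = 0)
      (independentTuples k (⊤ : Submodule F (Fin N → F))) x =
      independentTuples k (LinearMap.ker (A x).mulVecLin) := by
    intro x
    ext v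
    simp [mem_independentTuples, mem_bipartiteAbove]
  simp only [h2] at h1
  rw [h1, sum_mul, sum_congr rfl (g := fun _ => a * Fintype.card Ω), sum_const, smul_eq_mul]
  · ring
  · intro v hv
    exact h v (mem_independentTuples.1 hv).1

end Counting

theorem finrank_ker_funLeft_castLE (F : Type*) [Field F] (N D : ℕ) :
    Module.finrank F
      (LinearMap.ker (LinearMap.funLeft F F (Fin.castLE (Nat.le_add_right N D)))) = D := by
  have h := LinearMap.finrank_range_add_finrank_ker
    (LinearMap.funLeft F F (Fin.castLE (Nat.le_add_right N D)))
  rw [LinearMap.range_eq_top.2 (LinearMap.funLeft_surjective_of_injective _ _ _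
    (Fin.castLE_injective _)), finrank_top, Module.finrank_fin_fun, Module.finrank_fin_fun] at h
  omega

section Moments

open Finset Matrix

/-- A random variable `c` with `E[q^c - 1] ≥ 1/4` and bounded second moment of `q^c` has
tail beyond `r` bounded by a multiple of `q^{-r}` times the truncated expectation. -/
theorem tail_le_of_moments {Ω : Type*} [Fintype Ω] [Nonempty Ω] (c : Ω → ℕ) {q t : ℝ}
    (hq : 2 ≤ q) (ht : t = 1 / q) (r : ℕ)
    (h1 : (Fintype.card Ω : ℝ) / 4 ≤ ∑ x, (q ^ c x - 1))
    (h1' : ∑ x, (q ^ c x - 1) ≤ Fintype.card Ω)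
    (h2 : ∑ x, (q ^ c x - 1) * (q ^ c x - q) ≤ Fintype.card Ω)
    (hr : (2 * q + 3) * t ^ r ≤ 1 / 8) :
    (∑ x, if r < c x then (1 : ℝ) else 0) ≤
      8 * (2 * q + 3) * t ^ r *
        ∑ x, if c x ≤ r then t ^ (r - c x) - t ^ r else 0 := by
  have hq0 : 0 < q := by linarith
  have ht0 : 0 < t := by rw [ht]; positivity
  have hqt : q * t = 1 := by rw [ht]; field_simp
  set n : ℝ := (Fintype.card Ω : ℝ) with hn
  have hn0 : 0 < n := by rw [hn]; exact_mod_cast Fintype.card_pos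
  have hpow : ∀ k, q ^ k * t ^ k = 1 := fun k => by rw [← mul_pow, hqt, one_pow]
  have hsq : ∑ x, (q ^ c x) ^ 2 ≤ (2 * q + 3) * n := by
    have e : ∑ x, (q ^ c x) ^ 2 =
        ∑ x, (q ^ c x - 1) * (q ^ c x - q) + (q + 1) * ∑ x, (q ^ c x - 1) + n := by
      rw [mul_sum, ← sum_add_distrib]
      have : n = ∑ _x : Ω, (1 : ℝ) := by simp [hn]
      rw [this, ← sum_add_distrib]
      exact sum_congr rfl fun x _ => by ring
    rw [e]
    nlinarith
  have hgt : ∀ x, r < c x → 1 ≤ q ^ c x * t ^ r := fun x hx => by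
    rw [← hpow r]
    exact mul_le_mul_of_nonneg_right (pow_le_pow_right₀ (by linarith) hx.le) (by positivity)
  have htail : (∑ x, if r < c x then (1 : ℝ) else 0) ≤ (t ^ r) ^ 2 * ∑ x, (q ^ c x) ^ 2 := by
    rw [mul_sum]
    refine sum_le_sum fun x _ => ?_
    split_ifs with hx
    · nlinarith [hgt x hx]
    · positivity
  have hlow : t ^ r * ∑ x, (q ^ c x - 1) - (t ^ r) ^ 2 * ∑ x, (q ^ c x) ^ 2 ≤
      ∑ x, if c x ≤ r then t ^ (r - c x) - t ^ r else 0 := by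
    rw [mul_sum, mul_sum, ← sum_sub_distrib]
    refine sum_le_sum fun x _ => ?_
    split_ifs with hx
    · have e : t ^ (r - c x) = t ^ r * q ^ c x := by
        rw [← Nat.sub_add_cancel hx, pow_add, Nat.add_sub_cancel, mul_assoc,
          mul_comm (t ^ c x), hpow, mul_one]
      rw [e]
      nlinarith [sq_nonneg (t ^ r * q ^ c x)]
    · have h := hgt x (not_le.1 hx)
      have h3 : 0 < t ^ r := by positivity
      have h4 : 0 < q ^ c x * t ^ r := by positivity
      nlinarith
  have hs : 0 < t ^ r := by positivity
  have hE : t ^ r * n / 8 ≤ ∑ x, if c x ≤ r then t ^ (r - c x) - t ^ r else 0 := by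
    refine le_trans ?_ hlow
    have a1 : t ^ r * (n / 4) ≤ t ^ r * ∑ x, (q ^ c x - 1) := by gcongr
    have a2 : (t ^ r) ^ 2 * ∑ x, (q ^ c x) ^ 2 ≤ (t ^ r) ^ 2 * ((2 * q + 3) * n) := by gcongr
    have a3 : (t ^ r * n) * ((2 * q + 3) * t ^ r) ≤ (t ^ r * n) * (1 / 8) := by gcongr
    linarith
  calc _ ≤ (t ^ r) ^ 2 * ((2 * q + 3) * n) := htail.trans (by gcongr)
    _ = 8 * (2 * q + 3) * t ^ r * (t ^ r * n / 8) := by ring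
    _ ≤ _ := by gcongr

theorem isLittleO_tail_of_moments {Ω : ℕ → Type*} [∀ N, Fintype (Ω N)] [∀ N, Nonempty (Ω N)]
    (c : ∀ N, Ω N → ℕ) {q t : ℝ} (hq : 2 ≤ q) (ht : t = 1 / q) {r : ℕ → ℕ}
    (hr : Tendsto r atTop atTop)
    (h1 : ∀ᶠ N in atTop, (Fintype.card (Ω N) : ℝ) / 4 ≤ ∑ x, (q ^ c N x - 1))
    (h1' : ∀ᶠ N in atTop, ∑ x, (q ^ c N x - 1) ≤ Fintype.card (Ω N))
    (h2 : ∀ᶠ N in atTop, ∑ x, (q ^ c N x - 1) * (q ^ c N x - q) ≤ Fintype.card (Ω N)) :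
    (fun N => (∑ x, if r N < c N x then (1 : ℝ) else 0) / (Nat.card (Ω N) : ℝ)) =o[atTop]
      (fun N => (∑ x, if c N x ≤ r N then t ^ (r N - c N x) - t ^ r N else 0) /
        (Nat.card (Ω N) : ℝ)) := by
  have ht0 : 0 < t := by rw [ht]; positivity
  have ht1 : t < 1 := by rw [ht, div_lt_one (by linarith)]; linarith
  have hlim : Tendsto (fun N => t ^ r N) atTop (nhds 0) :=
    (tendsto_pow_atTop_nhds_zero_of_lt_one ht0.le ht1).comp hr
  have hlim1 : Tendsto (fun N => (2 * q + 3) * t ^ r N) atTop (nhds 0) := by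
    simpa using hlim.const_mul (2 * q + 3)
  have hlim2 : Tendsto (fun N => 8 * (2 * q + 3) * t ^ r N) atTop (nhds 0) := by
    simpa using hlim.const_mul (8 * (2 * q + 3))
  rw [Asymptotics.isLittleO_iff]
  intro ε hε
  filter_upwards [h1, h1', h2, hlim1.eventually_le_const (show (0 : ℝ) < 1 / 8 by norm_num),
    hlim2.eventually_le_const hε] with N a1 a1' a2 a3 a4
  have h := tail_le_of_moments (c N) hq ht (r N) a1 a1' a2 a3
  have hpos : 0 ≤ ∑ x, if c N x ≤ r N then t ^ (r N - c N x) - t ^ r N else 0 :=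
    sum_nonneg fun x _ => by
      split_ifs
      · exact sub_nonneg.2 (pow_le_pow_of_le_one ht0.le ht1.le (Nat.sub_le _ _))
      · exact le_rfl
  have hpos' : 0 ≤ ∑ x, if r N < c N x then (1 : ℝ) else 0 :=
    sum_nonneg fun x _ => by split_ifs <;> norm_num
  rw [Real.norm_of_nonneg (by positivity), Real.norm_of_nonneg (by positivity), ← mul_div_assoc]
  gcongr
  exact h.trans (by gcongr)

variable {F : Type*} [Field F] [Fintype F] [DecidableEq F]

theorem sum_pow_corank_sub_one {Ω : Type*} [Fintype Ω] {N a b : ℕ}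
    (A : Ω → Matrix (Fin N) (Fin N) F)
    (h : ∀ v : Fin 1 → Fin N → F, LinearIndependent F v →
      #{x | ∀ i, A x *ᵥ v i = 0} * b = a * Fintype.card Ω) :
    (∑ x, ((Fintype.card F : ℝ) ^ (N - (A x).rank) - 1)) * b =
      ((Fintype.card F : ℝ) ^ N - 1) * a * Fintype.card Ω := by
  have := congrArg (Nat.cast (R := ℝ)) (sum_card_independentTuples_ker A h)
  push_cast at this
  simpa [card_independentTuples_one, finrank_ker_mulVecLin] using this

theorem sum_pow_corank_sub_one_mul {Ω : Type*} [Fintype Ω] {N a b : ℕ}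
    (A : Ω → Matrix (Fin N) (Fin N) F)
    (h : ∀ v : Fin 2 → Fin N → F, LinearIndependent F v →
      #{x | ∀ i, A x *ᵥ v i = 0} * b = a * Fintype.card Ω) :
    (∑ x, ((Fintype.card F : ℝ) ^ (N - (A x).rank) - 1) *
        ((Fintype.card F : ℝ) ^ (N - (A x).rank) - Fintype.card F)) * b =
      ((Fintype.card F : ℝ) ^ N - 1) * ((Fintype.card F : ℝ) ^ N - Fintype.card F) * a *
        Fintype.card Ω := by
  have := congrArg (Nat.cast (R := ℝ)) (sum_card_independentTuples_ker A h)
  push_cast at this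
  simpa [card_independentTuples_two, finrank_ker_mulVecLin] using this

/-- The number of invertible matrices whose top-left corner kills an independent `k`-tuple. -/
theorem card_units_submatrix_kernel {N k : ℕ} (D : ℕ) {v : Fin k → Fin N → F}
    (hv : LinearIndependent F v) :
    #{g : (Matrix (Fin (N + D)) (Fin (N + D)) F)ˣ | ∀ i,
        ((g : Matrix (Fin (N + D)) (Fin (N + D)) F).submatrix
          (Fin.castLE (Nat.le_add_right N D)) (Fin.castLE (Nat.le_add_right N D))) *ᵥ v i = 0} *
        #(independentTuples k (⊤ : Submodule F (Fin (N + D) → F))) =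
      #(independentTuples k
          (LinearMap.ker (LinearMap.funLeft F F (Fin.castLE (Nat.le_add_right N D))))) *
        Fintype.card (Matrix (Fin (N + D)) (Fin (N + D)) F)ˣ := by
  have hu : LinearIndependent F fun i => (Fin.append (v i) 0 : Fin (N + D) → F) := by
    refine LinearIndependent.of_comp (LinearMap.funLeft F F (Fin.castAdd D)) ?_
    convert hv using 1
    ext i j
    simp [LinearMap.funLeft_apply]
  classical
  rw [← card_units_mulVec_mem hu]
  congr 3
  ext g
  refine forall_congr' fun i => ?_
  rw [LinearMap.mem_ker]
  refine Eq.congr ?_ rfl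
  ext j
  change _ = ((g : Matrix (Fin (N + D)) (Fin (N + D)) F) *ᵥ _) (Fin.castAdd D j)
  simp only [mulVec, dotProduct, Fin.sum_univ_add, Fin.append_left, Fin.append_right,
    Pi.zero_apply, mul_zero, sum_const_zero, add_zero]
  rfl

theorem sum_corankTL {F : Type} [Field F] [Fintype F] [DecidableEq F] (N D : ℕ) :
    (∑ g, ((Fintype.card F : ℝ) ^ corankTL F N D g - 1)) *
        ((Fintype.card F : ℝ) ^ N * (Fintype.card F : ℝ) ^ D - 1) =
      ((Fintype.card F : ℝ) ^ N - 1) * ((Fintype.card F : ℝ) ^ D - 1) *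
        Fintype.card (Matrix (Fin (N + D)) (Fin (N + D)) F)ˣ := by
  have e := sum_pow_corank_sub_one
    (fun g : (Matrix (Fin (N + D)) (Fin (N + D)) F)ˣ =>
      (g : Matrix (Fin (N + D)) (Fin (N + D)) F).submatrix
        (Fin.castLE (Nat.le_add_right N D)) (Fin.castLE (Nat.le_add_right N D)))
    fun v hv => card_units_submatrix_kernel D hv
  rwa [card_independentTuples_one, card_independentTuples_one, finrank_ker_funLeft_castLE,
    finrank_top, Module.finrank_fin_fun, pow_add] at e

theorem sum_corankTL_mul {F : Type} [Field F] [Fintype F] [DecidableEq F] (N D : ℕ) :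
    (∑ g, ((Fintype.card F : ℝ) ^ corankTL F N D g - 1) *
          ((Fintype.card F : ℝ) ^ corankTL F N D g - Fintype.card F)) *
        (((Fintype.card F : ℝ) ^ N * (Fintype.card F : ℝ) ^ D - 1) *
          ((Fintype.card F : ℝ) ^ N * (Fintype.card F : ℝ) ^ D - Fintype.card F)) =
      ((Fintype.card F : ℝ) ^ N - 1) * ((Fintype.card F : ℝ) ^ N - Fintype.card F) *
        (((Fintype.card F : ℝ) ^ D - 1) * ((Fintype.card F : ℝ) ^ D - Fintype.card F)) *
        Fintype.card (Matrix (Fin (N + D)) (Fin (N + D)) F)ˣ := by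
  have e := sum_pow_corank_sub_one_mul
    (fun g : (Matrix (Fin (N + D)) (Fin (N + D)) F)ˣ =>
      (g : Matrix (Fin (N + D)) (Fin (N + D)) F).submatrix
        (Fin.castLE (Nat.le_add_right N D)) (Fin.castLE (Nat.le_add_right N D)))
    fun v hv => card_units_submatrix_kernel D hv
  rwa [card_independentTuples_two, card_independentTuples_two, finrank_ker_funLeft_castLE,
    finrank_top, Module.finrank_fin_fun, pow_add] at e

end Moments

theorem statement18 (F : Type) [Field F] [Fintype F] [DecidableEq F]
    (q : ℕ) (hq : q = Fintype.card F) (t : ℝ) (ht : t = 1 / q)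
    (r : ℕ → ℕ) (hr1 : ∀ N, 1 ≤ r N) (hr : Tendsto r atTop atTop)
    (D : ℕ → ℕ) (hD : ∀ N, 1 ≤ D N) :
    ((fun N => (∑ g : (Matrix (Fin (N + D N)) (Fin (N + D N)) F)ˣ,
          if r N < corankTL F N (D N) g then (1 : ℝ) else 0) /
        (Nat.card (Matrix (Fin (N + D N)) (Fin (N + D N)) F)ˣ : ℝ))
      =o[atTop]
      (fun N => (∑ g : (Matrix (Fin (N + D N)) (Fin (N + D N)) F)ˣ,
          if corankTL F N (D N) g ≤ r N then
            t ^ (r N - corankTL F N (D N) g) - t ^ (r N) else 0) /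
        (Nat.card (Matrix (Fin (N + D N)) (Fin (N + D N)) F)ˣ : ℝ)))
    ∧
    ((fun N => (∑ M : Matrix (Fin N) (Fin N) F,
          if r N < N - M.rank then (1 : ℝ) else 0) /
        (Nat.card (Matrix (Fin N) (Fin N) F) : ℝ))
      =o[atTop]
      (fun N => (∑ M : Matrix (Fin N) (Fin N) F,
          if N - M.rank ≤ r N then t ^ (r N - (N - M.rank)) - t ^ (r N) else 0) /
        (Nat.card (Matrix (Fin N) (Fin N) F) : ℝ))) := by
  have hq2 : (2 : ℝ) ≤ Fintype.card F := by exact_mod_cast Fintype.one_lt_card (α := F)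
  have ht' : t = 1 / (Fintype.card F : ℝ) := by rw [ht, hq]
  have hpow : ∀ N, 1 ≤ N → (Fintype.card F : ℝ) ≤ (Fintype.card F : ℝ) ^ N := fun N h =>
    le_self_pow₀ (by linarith) (by omega)
  constructor
  · refine isLittleO_tail_of_moments (fun N => corankTL F N (D N)) hq2 ht' hr ?_ ?_ ?_ <;>
      filter_upwards [eventually_ge_atTop 1] with N hN1
    all_goals
      have hX := hpow N hN1
      have hY := hpow (D N) (hD N)
      have e := sum_corankTL (F := F) N (D N)
      have e2 := sum_corankTL_mul (F := F) N (D N)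
      set X := (Fintype.card F : ℝ) ^ N
      set Y := (Fintype.card F : ℝ) ^ D N
      set Q : ℝ := (Fintype.card F : ℝ)
      have hn : (0 : ℝ) ≤ Fintype.card (Matrix (Fin (N + D N)) (Fin (N + D N)) F)ˣ := by positivity
      have hXY : 2 * Q ≤ X * Y := by nlinarith
      have hb1 : 0 < X * Y - 1 := by linarith
      have hb2 : 0 < X * Y - Q := by linarith
    · refine le_of_mul_le_mul_right ?_ hb1
      rw [e, div_mul_eq_mul_div, div_le_iff₀ (by norm_num), mul_comm, mul_right_comm]
      gcongr
      nlinarith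
    · refine le_of_mul_le_mul_right ?_ hb1
      rw [e, mul_comm]
      gcongr
      nlinarith
    · refine le_of_mul_le_mul_right ?_ (mul_pos hb1 hb2)
      rw [e2, mul_comm]
      refine mul_le_mul_of_nonneg_left ?_ hn
      have h1 : (X - 1) * (Y - 1) ≤ X * Y - 1 := by nlinarith
      have h2 : (X - Q) * (Y - Q) ≤ X * Y - Q := by nlinarith
      calc _ = ((X - 1) * (Y - 1)) * ((X - Q) * (Y - Q)) := by ring
        _ ≤ _ := mul_le_mul h1 h2 (mul_nonneg (by linarith) (by linarith)) hb1.le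
  · refine isLittleO_tail_of_moments (fun N (M : Matrix (Fin N) (Fin N) F) => N - M.rank)
      hq2 ht' hr ?_ ?_ ?_ <;>
      filter_upwards [eventually_ge_atTop 1] with N hN1
    all_goals
      have hX := hpow N hN1
      have e := sum_pow_corank_sub_one (fun M : Matrix (Fin N) (Fin N) F => M) fun v hv =>
        (card_matrix_kernel hv).trans (one_mul _).symm
      have e2 := sum_pow_corank_sub_one_mul (fun M : Matrix (Fin N) (Fin N) F => M) fun v hv =>
        (card_matrix_kernel hv).trans (one_mul _).symm
      push_cast at e e2
      set X := (Fintype.card F : ℝ) ^ N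
      set Q : ℝ := (Fintype.card F : ℝ)
      have hn : (0 : ℝ) ≤ Fintype.card (Matrix (Fin N) (Fin N) F) := by positivity
      have hX0 : 0 < X := by linarith
    · refine le_of_mul_le_mul_right ?_ (pow_pos hX0 1)
      rw [e]
      nlinarith
    · refine le_of_mul_le_mul_right ?_ (pow_pos hX0 1)
      rw [e]
      nlinarith
    · refine le_of_mul_le_mul_right ?_ (pow_pos hX0 2)
      rw [e2, mul_comm _ (X ^ 2)]
      gcongr
      nlinarith
end
end
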